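/- arXiv:2003.12882 — 3 statements merged into one kernel-verified Lean document; each statement's English description precedes it below -/
import Mathlib

section
/- Let q be a prime power, n ≥ 2, and 1 ≤ m ≤ n−1. Then the number of elements g ∈ SL_n(F_q) whose fixed subspace {v ∈ F_q^n : gv = v} has dimension exactly m is at least (1 − 128·q^{−m})·q^{−m²}·|SL_n(F_q)|. -/
open Matrix in
/-- The special linear group acts on linearly independent families of vectors. -/
@[reducible]
noncomputable def linearIndependentMulAction (F ι κ : Type*) [Field F] [Fintype ι]
    [DecidableEq ι] :
    MulAction (SpecialLinearGroup ι F) {v : κ → ι → F // LinearIndependent F v} where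
  smul g v := ⟨fun i => SpecialLinearGroup.toLin' g (v.1 i),
    v.2.map' (SpecialLinearGroup.toLin' g : (ι → F) →ₗ[F] ι → F) (LinearEquiv.ker _)⟩
  one_smul v := Subtype.ext <| funext fun i => by
    change SpecialLinearGroup.toLin' 1 (v.1 i) = v.1 i
    rw [map_one]; rfl
  mul_smul g h v := Subtype.ext <| funext fun i => by
    change SpecialLinearGroup.toLin' (g * h) (v.1 i) =
      SpecialLinearGroup.toLin' g (SpecialLinearGroup.toLin' h (v.1 i))
    rw [map_mul]; rfl

/-- The fixed subspace of an element of the special linear group. -/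
abbrev Matrix.SpecialLinearGroup.fixedSubspace {F ι : Type*} [Field F] [Fintype ι]
    [DecidableEq ι] (g : Matrix.SpecialLinearGroup ι F) : Submodule F (ι → F) :=
  LinearMap.ker (Matrix.toLin' (g : Matrix ι ι F) - LinearMap.id)

/-- Independent families fixed by `g` are independent families in its fixed subspace. -/
noncomputable def fixedByEquivLinearIndependent {F ι : Type*} (κ : Type*) [Field F] [Fintype ι]
    [DecidableEq ι] (g : Matrix.SpecialLinearGroup ι F) :
    letI := linearIndependentMulAction F ι κ
    MulAction.fixedBy {v : κ → ι → F // LinearIndependent F v} g ≃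
      {s : κ → g.fixedSubspace // LinearIndependent F s} :=
  letI := linearIndependentMulAction F ι κ
  { toFun := fun v => ⟨fun i => ⟨v.1.1 i, by
        have h := congrFun (congrArg Subtype.val v.2) i
        rw [LinearMap.mem_ker, LinearMap.sub_apply, sub_eq_zero]
        exact h⟩, LinearIndependent.of_comp g.fixedSubspace.subtype v.1.2⟩
    invFun := fun s => ⟨⟨fun i => (s.1 i : ι → F),
        s.2.map' g.fixedSubspace.subtype (Submodule.ker_subtype _)⟩, by
        refine Subtype.ext <| funext fun i => ?_
        have h := (s.1 i).2
        rw [LinearMap.mem_ker, LinearMap.sub_apply, sub_eq_zero] at h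
        exact h⟩
    left_inv := fun _ => rfl
    right_inv := fun _ => rfl }

/-- Linearly independent families with the same index are related by an automorphism. -/
theorem LinearIndependent.exists_linearEquiv_apply_eq {K V κ : Type*} [Field K] [AddCommGroup V]
    [Module K V] [Finite κ] {v w : κ → V} (hv : LinearIndependent K v)
    (hw : LinearIndependent K w) : ∃ g : V ≃ₗ[K] V, ∀ i, g (v i) = w i := by
  have : FiniteDimensional K (Submodule.span K (Set.range v)) :=
    FiniteDimensional.span_of_finite K (Set.finite_range _)
  obtain ⟨g, hg⟩ := Submodule.exists_linearEquiv_restrict_eq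
    (hv.linearCombinationEquiv.symm ≪≫ₗ hw.linearCombinationEquiv)
  refine ⟨g, fun i => ?_⟩
  have hi : ((hv.linearCombinationEquiv (Finsupp.single i 1) :
      Submodule.span K (Set.range v)) : V) = v i := by simp
  rw [← hi, ← hg]
  simp

/-- The special linear group has at most `|F| - 1` orbits on independent families. -/
theorem card_orbits_linearIndependent_le (F ι κ : Type*) [Field F] [Finite F] [Fintype ι]
    [DecidableEq ι] [Finite κ] :
    letI := linearIndependentMulAction F ι κ
    Nat.card (MulAction.orbitRel.Quotient (Matrix.SpecialLinearGroup ι F)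
      {v : κ → ι → F // LinearIndependent F v}) ≤ Nat.card Fˣ := by
  let _ := linearIndependentMulAction F ι κ
  rcases isEmpty_or_nonempty {v : κ → ι → F // LinearIndependent F v} with h | ⟨⟨e⟩⟩
  · have : IsEmpty (MulAction.orbitRel.Quotient (Matrix.SpecialLinearGroup ι F)
        {v : κ → ι → F // LinearIndependent F v}) := Quotient.instIsEmpty
    simp
  choose g hg using fun o : MulAction.orbitRel.Quotient (Matrix.SpecialLinearGroup ι F)
    {v : κ → ι → F // LinearIndependent F v} => e.2.exists_linearEquiv_apply_eq o.out.2
  refine Nat.card_le_card_of_injective (fun o => LinearEquiv.det (g o)) fun o o' h => ?_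
  rw [← Quotient.out_eq o, ← Quotient.out_eq o']
  refine Quotient.sound ?_
  have hdet : LinearEquiv.det (g o * (g o')⁻¹) = 1 := by
    rw [map_mul, map_inv, mul_inv_eq_one]
    exact h
  refine ⟨⟨LinearMap.toMatrix' ((g o * (g o')⁻¹ : (ι → F) ≃ₗ[F] ι → F) :
      (ι → F) →ₗ[F] ι → F), ?_⟩, ?_⟩
  · rw [LinearMap.det_toMatrix', ← LinearEquiv.coe_det, hdet, Units.val_one]
  · refine Subtype.ext <| funext fun i => ?_
    change Matrix.toLin' (LinearMap.toMatrix' _) (o'.out.1 i) = o.out.1 i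
    rw [Matrix.toLin'_toMatrix', ← hg, ← hg]
    change g o ((g o').symm (g o' (e.1 i))) = _
    rw [LinearEquiv.symm_apply_apply]

/-- The number of linearly independent families, without a restriction on their length. -/
theorem cast_card_linearIndependent (K V : Type*) [Field K] [Fintype K] [AddCommGroup V]
    [Module K V] [FiniteDimensional K V] (k : ℕ) :
    (Nat.card {s : Fin k → V // LinearIndependent K s} : ℝ) =
      ∏ i ∈ Finset.range k,
        ((Fintype.card K : ℝ) ^ Module.finrank K V - (Fintype.card K : ℝ) ^ i) := by
  have : Finite V := Module.finite_of_finite K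
  rcases le_or_gt k (Module.finrank K V) with hk | hk
  · rw [card_linearIndependent hk, Finset.prod_range, Nat.cast_prod]
    refine Finset.prod_congr rfl fun i _ => ?_
    rw [Nat.cast_sub (Nat.pow_le_pow_right Fintype.card_pos (i.2.le.trans hk))]
    push_cast
    rfl
  · have : IsEmpty {s : Fin k → V // LinearIndependent K s} :=
      ⟨fun s => hk.not_ge (by simpa using s.2.fintype_card_le_finrank)⟩
    rw [Finset.prod_eq_zero (Finset.mem_range.mpr hk) (sub_self _)]
    simp

theorem sum_card_linearIndependent_fixedSubspace (F : Type*) [Field F] [Fintype F]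
    [DecidableEq F] (n k : ℕ) :
    letI := linearIndependentMulAction F (Fin n) (Fin k)
    ∑ g : Matrix.SpecialLinearGroup (Fin n) F,
        Nat.card {s : Fin k → g.fixedSubspace // LinearIndependent F s} =
      Nat.card (MulAction.orbitRel.Quotient (Matrix.SpecialLinearGroup (Fin n) F)
        {v : Fin k → Fin n → F // LinearIndependent F v}) *
        Nat.card (Matrix.SpecialLinearGroup (Fin n) F) := by
  classical
  let _ := linearIndependentMulAction F (Fin n) (Fin k)
  rw [← Nat.card_prod, ← Nat.card_congr (MulAction.sigmaFixedByEquivOrbitsProdGroup _ _),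
    Nat.card_sigma]
  exact Finset.sum_congr rfl fun g _ =>
    (Nat.card_congr (fixedByEquivLinearIndependent (Fin k) g)).symm

theorem card_le_sum_card_linearIndependent_fixedSubspace (F : Type*) [Field F] [Fintype F]
    [DecidableEq F] {n k : ℕ} (hk : k ≤ n) :
    Nat.card (Matrix.SpecialLinearGroup (Fin n) F) ≤
      ∑ g : Matrix.SpecialLinearGroup (Fin n) F,
        Nat.card {s : Fin k → g.fixedSubspace // LinearIndependent F s} := by
  let _ := linearIndependentMulAction F (Fin n) (Fin k)
  rw [sum_card_linearIndependent_fixedSubspace]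
  refine Nat.le_mul_of_pos_left _ ?_
  have : Nonempty {v : Fin k → Fin n → F // LinearIndependent F v} :=
    ⟨⟨_, (Pi.basisFun F (Fin n)).linearIndependent.comp _ (Fin.castLE_injective hk)⟩⟩
  have : Nonempty (MulAction.orbitRel.Quotient (Matrix.SpecialLinearGroup (Fin n) F)
    {v : Fin k → Fin n → F // LinearIndependent F v}) := this.map (Quotient.mk _)
  have : Finite (MulAction.orbitRel.Quotient (Matrix.SpecialLinearGroup (Fin n) F)
    {v : Fin k → Fin n → F // LinearIndependent F v}) := Quotient.finite _
  exact Nat.card_pos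

theorem sum_card_linearIndependent_fixedSubspace_le (F : Type*) [Field F] [Fintype F]
    [DecidableEq F] (n k : ℕ) :
    ∑ g : Matrix.SpecialLinearGroup (Fin n) F,
        Nat.card {s : Fin k → g.fixedSubspace // LinearIndependent F s} ≤
      (Fintype.card F - 1) * Nat.card (Matrix.SpecialLinearGroup (Fin n) F) := by
  rw [sum_card_linearIndependent_fixedSubspace, ← Fintype.card_units,
    ← Nat.card_eq_fintype_card (α := Fˣ)]
  exact Nat.mul_le_mul_right _ (card_orbits_linearIndependent_le F (Fin n) (Fin k))

/-- Truncating after two terms gives a lower bound for the indicator function of `d = m`. -/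
theorem prod_pow_sub_pow_truncation {q : ℝ} (hq : 1 < q) (d m : ℕ) :
    (∏ i ∈ Finset.range m, (q ^ d - q ^ i)) * (q ^ m * (q - 1)) -
        ∏ i ∈ Finset.range (m + 1), (q ^ d - q ^ i) ≤
      if d = m then q ^ (m ^ 2) * (q ^ m * (q - 1)) else 0 := by
  have hq0 : 0 < q := zero_lt_one.trans hq
  rw [Finset.prod_range_succ, ← mul_sub]
  rcases lt_trichotomy d m with h | rfl | h
  · rw [Finset.prod_eq_zero (Finset.mem_range.mpr h) (sub_self _), zero_mul, if_neg h.ne]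
  · rw [if_pos rfl, sub_self, sub_zero]
    refine mul_le_mul_of_nonneg_right ?_ (mul_nonneg (by positivity) (sub_nonneg.mpr hq.le))
    rw [sq, pow_mul]
    refine (Finset.prod_le_prod (g := fun _ => q ^ d) (fun i hi => sub_nonneg.mpr <|
      pow_le_pow_right₀ hq.le (Finset.mem_range.mp hi).le) fun i _ => ?_).trans_eq (by simp)
    exact sub_le_self _ (by positivity)
  · rw [if_neg h.ne']
    refine mul_nonpos_of_nonneg_of_nonpos (Finset.prod_nonneg fun i hi => sub_nonneg.mpr <|
      pow_le_pow_right₀ hq.le ((Finset.mem_range.mp hi).le.trans h.le)) ?_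
    have := pow_le_pow_right₀ hq.le h
    rw [Nat.succ_eq_add_one, pow_succ] at this
    linarith

/-- the number of elements of `SL_n(F_q)` whose fixed subspace has
dimension exactly `m` is at least `(1 - 128/q^m) * q^(-m²) * |SL_n(F_q)|`. -/
theorem stmt_5 (F : Type*) [Field F] [Fintype F] [DecidableEq F]
    (n m : ℕ) (hn : 2 ≤ n) (hm1 : 1 ≤ m) (hm2 : m ≤ n - 1) :
    (1 - 128 * (Fintype.card F : ℝ) ^ (-(m : ℤ))) * (Fintype.card F : ℝ) ^ (-(m ^ 2 : ℤ)) *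
        Nat.card (Matrix.SpecialLinearGroup (Fin n) F) ≤
      (Nat.card {g : Matrix.SpecialLinearGroup (Fin n) F |
        Module.finrank F (LinearMap.ker
          (Matrix.toLin' (g : Matrix (Fin n) (Fin n) F) - LinearMap.id)) = m} : ℝ) := by
  have hq : (1 : ℝ) < Fintype.card F := by exact_mod_cast Fintype.one_lt_card
  have hlow := card_le_sum_card_linearIndependent_fixedSubspace F (hm2.trans (n.sub_le 1))
  have hup := sum_card_linearIndependent_fixedSubspace_le F n (m + 1)
  have hcard : Nat.card {g : Matrix.SpecialLinearGroup (Fin n) F |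
      Module.finrank F (LinearMap.ker
        (Matrix.toLin' (g : Matrix (Fin n) (Fin n) F) - LinearMap.id)) = m} =
      (Finset.univ.filter fun g : Matrix.SpecialLinearGroup (Fin n) F =>
        Module.finrank F g.fixedSubspace = m).card := by
    rw [Nat.card_coe_set_eq, ← Set.ncard_coe_finset]
    simp
  rw [hcard]
  rify at hlow hup
  rw [Nat.cast_sub Fintype.card_pos] at hup
  simp only [cast_card_linearIndependent] at hlow hup
  have hsum := Finset.sum_le_sum fun (g : Matrix.SpecialLinearGroup (Fin n) F)
    (_ : g ∈ Finset.univ) => prod_pow_sub_pow_truncation hq (Module.finrank F g.fixedSubspace) m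
  rw [Finset.sum_sub_distrib, ← Finset.sum_mul, ← Finset.sum_filter, Finset.sum_const,
    nsmul_eq_mul] at hsum
  set q : ℝ := (Fintype.card F : ℝ)
  set G : ℝ := (Nat.card (Matrix.SpecialLinearGroup (Fin n) F) : ℝ)
  set N : ℝ := ((Finset.univ.filter fun g : Matrix.SpecialLinearGroup (Fin n) F =>
    Module.finrank F g.fixedSubspace = m).card : ℝ)
  have hG : 0 ≤ G := Nat.cast_nonneg _
  have hqm : 0 < q ^ m := by positivity
  have hqm2 : 0 < q ^ (m ^ 2) := by positivity
  have hmain : (q ^ m - 1) * G ≤ N * (q ^ (m ^ 2) * q ^ m) := by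
    refine le_of_mul_le_mul_right ?_ (sub_pos.mpr hq)
    have := mul_le_mul_of_nonneg_right hlow (mul_nonneg hqm.le (sub_pos.mpr hq).le)
    push_cast at hup
    linarith
  have h2 : (q : ℝ) ^ (-(m ^ 2 : ℤ)) = (q ^ (m ^ 2))⁻¹ := by
    rw [zpow_neg]; exact_mod_cast rfl
  rw [h2, zpow_neg, zpow_natCast]
  calc (1 - 128 * (q ^ m)⁻¹) * (q ^ (m ^ 2))⁻¹ * G
      ≤ (1 - (q ^ m)⁻¹) * (q ^ (m ^ 2))⁻¹ * G := by
        gcongr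
        linarith [inv_pos.mpr hqm]
    _ = (q ^ m - 1) * G / (q ^ (m ^ 2) * q ^ m) := by field_simp
    _ ≤ N := (div_le_iff₀ (by positivity)).mpr hmain
end

section
/- Let 0 ≤ s, t ≤ 1 be real numbers. (i) If s + t ≤ 1, then there exist sequences of normal subsets S_n, T_n ⊆ A_n (n ≥ 3) such that |S_n|/|A_n| → s and |T_n|/|A_n| → t as n → ∞, and for every n the product set S_nT_n contains no 3-cycle. (ii) If s + t > 1, then for any sequences of subsets S_n, T_n ⊆ A_n with |S_n|/|A_n| → s and |T_n|/|A_n| → t, one has S_nT_n = A_n for all sufficiently large n. -/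
open Pointwise

section CycleCount

open Equiv Equiv.Perm Module

variable {α : Type*}

/-- The rational functions that are constant on the cycles of `σ`. -/
def invariantFunctions (σ : Perm α) : Submodule ℚ (α → ℚ) where
  carrier := {f | ∀ i, f (σ i) = f i}
  add_mem' hf hg i := by simp [hf i, hg i]
  zero_mem' _ := rfl
  smul_mem' c f hf i := by simp [hf i]

theorem mem_invariantFunctions {σ : Perm α} {f : α → ℚ} :
    f ∈ invariantFunctions σ ↔ ∀ i, f (σ i) = f i :=
  Iff.rfl

/-- The number of cycles of `σ` (fixed points included), as the dimension of the space of
invariant functions. -/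
noncomputable def cycleCount (σ : Perm α) : ℕ :=
  finrank ℚ (invariantFunctions σ)

theorem invariantFunctions_inv (σ : Perm α) :
    invariantFunctions σ⁻¹ = invariantFunctions σ := by
  ext f
  simp only [mem_invariantFunctions]
  refine ⟨fun h i => ?_, fun h i => ?_⟩
  · simpa using (h (σ i)).symm
  · simpa using (h (σ⁻¹ i)).symm

theorem cycleCount_inv (σ : Perm α) : cycleCount σ⁻¹ = cycleCount σ := by
  rw [cycleCount, invariantFunctions_inv, cycleCount]

theorem cycleCount_conj (g σ : Perm α) : cycleCount (g * σ * g⁻¹) = cycleCount σ := by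
  refine LinearEquiv.finrank_eq <|
    (LinearEquiv.funCongrLeft ℚ ℚ g).ofSubmodules _ _ (Submodule.ext fun f => ?_)
  rw [Submodule.mem_map_equiv]
  simp only [mem_invariantFunctions, LinearEquiv.funCongrLeft_symm, LinearEquiv.funCongrLeft_apply,
    LinearMap.funLeft_apply, Perm.mul_apply]
  refine ⟨fun h i => ?_, fun h i => ?_⟩
  · simpa using h (g i)
  · simpa using h (g⁻¹ i)

theorem cycleCount_le_card [Fintype α] (σ : Perm α) : cycleCount σ ≤ Fintype.card α :=
  (Submodule.finrank_le _).trans_eq (finrank_fintype_fun_eq_card ℚ)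

theorem finrank_le_finrank_inf_ker_add_one {K V : Type*} [Field K] [AddCommGroup V] [Module K V]
    [FiniteDimensional K V] (W : Submodule K V) (φ : V →ₗ[K] K) :
    finrank K W ≤ finrank K (W ⊓ LinearMap.ker φ : Submodule K V) + 1 := by
  have h := (φ.domRestrict W).finrank_range_add_finrank_ker
  have h1 : finrank K (LinearMap.range (φ.domRestrict W)) ≤ 1 :=
    (Submodule.finrank_le _).trans_eq (finrank_self K)
  have h2 : finrank K (LinearMap.ker (φ.domRestrict W)) =
      finrank K (W ⊓ LinearMap.ker φ : Submodule K V) := by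
    rw [LinearMap.ker_domRestrict, ← Submodule.map_comap_subtype]
    exact (LinearEquiv.finrank_eq
      (Submodule.equivMapOfInjective _ W.injective_subtype _))
  omega

theorem cycleCount_le_cycleCount_mul_add_two [Fintype α] [DecidableEq α] (σ : Perm α)
    {τ : Perm α} (hτ : τ.IsThreeCycle) : cycleCount σ ≤ cycleCount (σ * τ) + 2 := by
  obtain ⟨a, b, c, -, -, -, hs⟩ := Finset.card_eq_three.1 hτ.card_support
  let φ (x y : α) : (α → ℚ) →ₗ[ℚ] ℚ :=
    (LinearMap.proj x : (α → ℚ) →ₗ[ℚ] ℚ) - LinearMap.proj y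
  have h1 := finrank_le_finrank_inf_ker_add_one (invariantFunctions σ) (φ a b)
  have h2 := finrank_le_finrank_inf_ker_add_one
    (invariantFunctions σ ⊓ LinearMap.ker (φ a b)) (φ b c)
  have h3 : invariantFunctions σ ⊓ LinearMap.ker (φ a b) ⊓ LinearMap.ker (φ b c) ≤
      invariantFunctions (σ * τ) := by
    rintro f ⟨⟨hf, hab⟩, hbc⟩ i
    have hab : f a = f b := sub_eq_zero.1 hab
    have hbc : f b = f c := sub_eq_zero.1 hbc
    have key : ∀ x ∈ τ.support, f x = f c := by
      intro x hx
      rw [hs] at hx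
      simp only [Finset.mem_insert, Finset.mem_singleton] at hx
      rcases hx with rfl | rfl | rfl <;> simp [hab, hbc]
    rw [Perm.mul_apply, hf]
    by_cases hi : i ∈ τ.support
    · rw [key _ hi, key _ (apply_mem_support.2 hi)]
    · rw [notMem_support.1 hi]
  have h4 := Submodule.finrank_mono h3
  unfold cycleCount
  omega

theorem cycleCount_decomposeFin_symm_zero {n : ℕ} (e : Perm (Fin n)) :
    cycleCount (decomposeFin.symm (0, e)) = cycleCount e + 1 := by
  let L : invariantFunctions (decomposeFin.symm (0, e)) ≃ₗ[ℚ] ℚ × invariantFunctions e :=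
    { toFun := fun f => (f.1 0, ⟨fun i => f.1 i.succ, fun i => by simpa using f.2 i.succ⟩)
      invFun := fun g => ⟨Fin.cons g.1 g.2.1, fun i => by
        refine Fin.cases ?_ (fun j => ?_) i
        · simp
        · simpa using g.2.2 j⟩
      map_add' := fun _ _ => rfl
      map_smul' := fun _ _ => rfl
      left_inv := fun f => Subtype.ext (Fin.cons_self_tail f.1)
      right_inv := fun _ => rfl }
  rw [cycleCount, L.finrank_eq, finrank_prod, finrank_self, add_comm, cycleCount]

theorem cycleCount_decomposeFin_symm_succ {n : ℕ} (j : Fin n) (e : Perm (Fin n)) :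
    cycleCount (decomposeFin.symm (j.succ, e)) = cycleCount e := by
  have merge (f : Fin (n + 1) → ℚ) (hf : f 0 = f j.succ) (i : Fin (n + 1)) :
      f (swap 0 j.succ i) = f i := by
    rcases eq_or_ne i 0 with rfl | h0
    · simp [hf]
    rcases eq_or_ne i j.succ with rfl | h1
    · simp [hf]
    · rw [swap_apply_of_ne_of_ne h0 h1]
  let L : invariantFunctions (decomposeFin.symm (j.succ, e)) ≃ₗ[ℚ] invariantFunctions e :=
    { toFun := fun f => ⟨fun i => f.1 i.succ, fun i => by
        have h0 := f.2 0
        have h := f.2 i.succ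
        rw [decomposeFin_symm_apply_zero] at h0
        rwa [decomposeFin_symm_apply_succ, merge f.1 h0.symm] at h⟩
      invFun := fun g => ⟨Fin.cons (g.1 j) g.1, fun i => by
        refine Fin.cases ?_ (fun k => ?_) i
        · simp
        · rw [decomposeFin_symm_apply_succ, merge (Fin.cons (g.1 j) g.1) (by simp)]
          simpa using g.2 k⟩
      map_add' := fun _ _ => rfl
      map_smul' := fun _ _ => rfl
      left_inv := fun f => Subtype.ext <| by
        have h0 := f.2 0
        rw [decomposeFin_symm_apply_zero] at h0
        funext i
        refine Fin.cases ?_ (fun k => ?_) i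
        · simpa using h0
        · simp
      right_inv := fun _ => rfl }
  exact L.finrank_eq

/-- The proportion of the permutations of `Fin n` that have exactly `k` cycles. -/
noncomputable def cycleDensity (n k : ℕ) : ℝ :=
  (Finset.univ.filter fun σ : Perm (Fin n) => cycleCount σ = k).card / (n.factorial : ℝ)

theorem cycleCount_fin_zero (σ : Perm (Fin 0)) : cycleCount σ = 0 :=
  Nat.le_zero.1 (by simpa using cycleCount_le_card σ)

theorem cycleDensity_zero_zero : cycleDensity 0 0 = 1 := by
  simp [cycleDensity, cycleCount_fin_zero]

theorem cycleDensity_zero_succ (k : ℕ) : cycleDensity 0 (k + 1) = 0 := by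
  simp [cycleDensity, cycleCount_fin_zero]

theorem card_cycleCount_succ (n k : ℕ) :
    (Finset.univ.filter fun σ : Perm (Fin (n + 1)) => cycleCount σ = k).card =
      (Finset.univ.filter fun σ : Perm (Fin n) => cycleCount σ + 1 = k).card +
        n * (Finset.univ.filter fun σ : Perm (Fin n) => cycleCount σ = k).card := by
  simp only [Finset.card_filter]
  rw [← Equiv.sum_comp decomposeFin.symm, Fintype.sum_prod_type, Fin.sum_univ_succ]
  simp only [cycleCount_decomposeFin_symm_zero, cycleCount_decomposeFin_symm_succ]
  simp

theorem cycleDensity_succ_zero (n : ℕ) :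
    cycleDensity (n + 1) 0 = (1 - 1 / (n + 1 : ℝ)) * cycleDensity n 0 := by
  have := n.factorial_pos
  simp only [cycleDensity, card_cycleCount_succ, Nat.factorial_succ]
  push_cast
  field_simp
  simp [mul_comm]

theorem cycleDensity_succ_succ (n k : ℕ) :
    cycleDensity (n + 1) (k + 1) = (1 - 1 / (n + 1 : ℝ)) * cycleDensity n (k + 1) +
      1 / (n + 1 : ℝ) * cycleDensity n k := by
  have := n.factorial_pos
  simp only [cycleDensity, card_cycleCount_succ, Nat.factorial_succ, add_left_inj]
  push_cast
  field_simp
  ring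

end CycleCount

section Smoothing

open Finset

theorem sq_sq_le_four_mul_sum_sq_sub_mul_sum_sq {p : ℕ → ℝ} {N : ℕ} (hN : p N = 0) {k : ℕ}
    (hk : k ≤ N) :
    (p k ^ 2) ^ 2 ≤
      (∑ j ∈ range N, (p (j + 1) - p j) ^ 2) * (4 * ∑ j ∈ range N, p j ^ 2) := by
  have h1 : p k ^ 2 = ∑ j ∈ Ico k N, (p (j + 1) - p j) * (-(p (j + 1) + p j)) := by
    have h := Finset.sum_Ico_sub (fun j => - p j ^ 2) hk
    simp only [hN] at h
    rw [show p k ^ 2 = -0 ^ 2 - -p k ^ 2 by ring, ← h]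
    exact sum_congr rfl fun j _ => by ring
  have hsub : Ico k N ⊆ range N := fun j hj => mem_range.2 (mem_Ico.1 hj).2
  have h2 : ∑ j ∈ range N, p (j + 1) ^ 2 ≤ ∑ j ∈ range N, p j ^ 2 := by
    have := sum_range_succ (fun j => p j ^ 2) N
    rw [sum_range_succ', hN] at this
    nlinarith [sq_nonneg (p 0)]
  rw [h1]
  refine (sum_mul_sq_le_sq_mul_sq _ _ _).trans ?_
  refine mul_le_mul (sum_le_sum_of_subset_of_nonneg hsub fun _ _ _ => sq_nonneg _) ?_
    (sum_nonneg fun j _ => sq_nonneg _) (sum_nonneg fun j _ => sq_nonneg _)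
  calc ∑ j ∈ Ico k N, (-(p (j + 1) + p j)) ^ 2
        ≤ ∑ j ∈ range N, (-(p (j + 1) + p j)) ^ 2 :=
          sum_le_sum_of_subset_of_nonneg hsub fun _ _ _ => sq_nonneg _
      _ ≤ ∑ j ∈ range N, (2 * p (j + 1) ^ 2 + 2 * p j ^ 2) :=
          sum_le_sum fun j _ => by nlinarith [sq_nonneg (p (j + 1) - p j)]
      _ ≤ 4 * ∑ j ∈ range N, p j ^ 2 := by
          rw [sum_add_distrib, ← mul_sum, ← mul_sum]
          linarith

/-- A discrete Nash inequality for probability vectors. -/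
theorem sum_sq_pow_three_le {p : ℕ → ℝ} {N : ℕ} (hp : ∀ k, 0 ≤ p k) (hN : p N = 0)
    (hsum : ∑ j ∈ range N, p j = 1) :
    (∑ j ∈ range N, p j ^ 2) ^ 3 ≤ 4 * ∑ j ∈ range N, (p (j + 1) - p j) ^ 2 := by
  set E := ∑ j ∈ range N, p j ^ 2
  set D := ∑ j ∈ range N, (p (j + 1) - p j) ^ 2
  have hD0 : 0 ≤ D := sum_nonneg fun j _ => sq_nonneg _
  have hE0 : 0 ≤ E := sum_nonneg fun j _ => sq_nonneg _
  have hne : (range N).Nonempty := by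
    rw [nonempty_iff_ne_empty]
    intro h
    simp [h] at hsum
  obtain ⟨k, hk, hmax⟩ := exists_max_image (range N) p hne
  have hEk : E ≤ p k := by
    calc E ≤ ∑ j ∈ range N, p k * p j :=
          sum_le_sum fun j hj => by nlinarith [hmax j hj, hp j]
      _ = p k := by rw [← mul_sum, hsum, mul_one]
  have h4 : E ^ 4 ≤ D * (4 * E) :=
    (pow_le_pow_left₀ hE0 hEk 4).trans <| by
      have := sq_sq_le_four_mul_sum_sq_sub_mul_sum_sq hN (mem_range.1 hk).le
      rwa [← pow_mul] at this
  rcases hE0.eq_or_lt with h | h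
  · rw [← h]; simpa using hD0
  · refine le_of_mul_le_mul_right ?_ h
    linarith

theorem sum_sq_bernoulli_convolution {p q : ℕ → ℝ} {a : ℝ} {N : ℕ} (hN : p N = 0)
    (h0 : q 0 = (1 - a) * p 0) (hs : ∀ k, q (k + 1) = (1 - a) * p (k + 1) + a * p k) :
    ∑ j ∈ range (N + 1), q j ^ 2 = ∑ j ∈ range N, p j ^ 2 -
      a * (1 - a) * (p 0 ^ 2 + ∑ j ∈ range N, (p (j + 1) - p j) ^ 2) := by
  have h := sum_range_succ' (fun j => p j ^ 2) N
  rw [sum_range_succ, hN] at h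
  have e : ∑ j ∈ range N, q (j + 1) ^ 2 = (1 - a) * ∑ j ∈ range N, p (j + 1) ^ 2 +
      a * ∑ j ∈ range N, p j ^ 2 - a * (1 - a) * ∑ j ∈ range N, (p (j + 1) - p j) ^ 2 := by
    simp only [mul_sum, ← sum_add_distrib, ← sum_sub_distrib, hs]
    exact sum_congr rfl fun j _ => by ring
  rw [sum_range_succ', e, h0]
  linear_combination (a - 1) * h

theorem tendsto_zero_of_cubic_decay {E : ℕ → ℝ} (h0 : ∀ n, 0 ≤ E n) (h1 : E 0 ≤ 1)
    (hstep : ∀ n : ℕ, E (n + 1) ≤ E n - 1 / (n + 1 : ℝ) * (1 - 1 / (n + 1 : ℝ)) * (E n ^ 3 / 4)) :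
    Filter.Tendsto E Filter.atTop (nhds 0) := by
  have hw (n : ℕ) : 0 ≤ 1 / (n + 1 : ℝ) * (1 - 1 / (n + 1 : ℝ)) := by
    have : (1 : ℝ) / (n + 1) ≤ 1 := by
      rw [div_le_one (by positivity)]; linarith [n.cast_nonneg (α := ℝ)]
    exact mul_nonneg (by positivity) (by linarith)
  have hanti : Antitone E := antitone_nat_of_succ_le fun n =>
    (hstep n).trans (sub_le_self _ (mul_nonneg (hw n) (by have := h0 n; positivity)))
  rw [Metric.tendsto_atTop]
  intro ε hε
  suffices ∃ N, E N < ε by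
    obtain ⟨N, hN⟩ := this
    refine ⟨N, fun n hn => ?_⟩
    rw [Real.dist_eq, sub_zero, abs_of_nonneg (h0 n)]
    exact (hanti hn).trans_lt hN
  by_contra! hge
  set c := ε ^ 3 / 8 with hc
  have hc0 : 0 < c := by positivity
  have key (n : ℕ) : E n ≤ 1 + c - c * ∑ k ∈ range n, 1 / (k + 1 : ℝ) := by
    induction n with
    | zero => simp; linarith
    | succ n ih =>
      rcases n.eq_zero_or_pos with rfl | hn
      · simpa using (hanti zero_le_one).trans h1
      · have hE : ε ^ 3 ≤ E n ^ 3 := pow_le_pow_left₀ hε.le (hge n) 3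
        have hn' : (1 : ℝ) ≤ n := by exact_mod_cast hn
        have hhalf : 1 / (n + 1 : ℝ) ≤ 1 / 2 :=
          one_div_le_one_div_of_le (by norm_num) (by linarith)
        have hpos : 0 < 1 / (n + 1 : ℝ) := by positivity
        have h2 : 1 / (n + 1 : ℝ) * (1 - 1 / (n + 1 : ℝ)) * (ε ^ 3 / 4) ≤
            1 / (n + 1 : ℝ) * (1 - 1 / (n + 1 : ℝ)) * (E n ^ 3 / 4) :=
          mul_le_mul_of_nonneg_left (by linarith) (hw n)
        have h3 : c * (1 / (n + 1 : ℝ)) ≤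
            1 / (n + 1 : ℝ) * (1 - 1 / (n + 1 : ℝ)) * (ε ^ 3 / 4) := by
          have : 0 ≤ 1 / (n + 1 : ℝ) * c * (1 / 2 - 1 / (n + 1 : ℝ)) :=
            mul_nonneg (by positivity) (by linarith)
          rw [show ε ^ 3 / 4 = 2 * c by rw [hc]; ring]
          linarith
        rw [sum_range_succ, mul_add]
        linarith [hstep n]
  obtain ⟨n, hn⟩ := (Real.tendsto_sum_range_one_div_nat_succ_atTop.eventually_gt_atTop
    ((1 + c) / c)).exists
  rw [div_lt_iff₀ hc0] at hn
  linarith [key n, h0 n]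

theorem cycleDensity_nonneg (n k : ℕ) : 0 ≤ cycleDensity n k := by
  unfold cycleDensity; positivity

theorem cycleDensity_eq_zero_of_lt {n k : ℕ} (h : n < k) : cycleDensity n k = 0 := by
  rw [cycleDensity, filter_false_of_mem, card_empty, Nat.cast_zero, zero_div]
  intro σ _ hσ
  have := cycleCount_le_card σ
  rw [Fintype.card_fin] at this
  omega

theorem sum_cycleDensity (n : ℕ) : ∑ k ∈ range (n + 1), cycleDensity n k = 1 := by
  induction n with
  | zero => simp [cycleDensity_zero_zero]
  | succ n ih =>
    have h := sum_range_succ (fun k => cycleDensity n k) (n + 1)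
    rw [ih, cycleDensity_eq_zero_of_lt n.lt_succ_self, sum_range_succ'] at h
    rw [sum_range_succ']
    simp only [cycleDensity_succ_succ, cycleDensity_succ_zero, sum_add_distrib, ← mul_sum, ih]
    linear_combination (1 - 1 / (n + 1 : ℝ)) * h

theorem tendsto_sum_sq_cycleDensity :
    Filter.Tendsto (fun n => ∑ k ∈ range (n + 1), cycleDensity n k ^ 2) Filter.atTop (nhds 0) := by
  refine tendsto_zero_of_cubic_decay (fun n => sum_nonneg fun k _ => sq_nonneg _)
    (by simp [cycleDensity_zero_zero]) fun n => ?_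
  have hN := cycleDensity_eq_zero_of_lt n.lt_succ_self
  rw [sum_sq_bernoulli_convolution hN (cycleDensity_succ_zero n) (cycleDensity_succ_succ n)]
  have hnash := sum_sq_pow_three_le (cycleDensity_nonneg n) hN (sum_cycleDensity n)
  have hle : (1 : ℝ) / (n + 1) ≤ 1 := by
    rw [div_le_one (by positivity)]; linarith [n.cast_nonneg (α := ℝ)]
  have hw : 0 ≤ 1 / (n + 1 : ℝ) * (1 - 1 / (n + 1 : ℝ)) :=
    mul_nonneg (by positivity) (by linarith)
  gcongr
  linarith [sq_nonneg (cycleDensity n 0)]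

theorem cycleDensity_le_sqrt (n k : ℕ) :
    cycleDensity n k ≤ √(∑ k ∈ range (n + 1), cycleDensity n k ^ 2) := by
  rcases lt_or_ge n k with h | h
  · rw [cycleDensity_eq_zero_of_lt h]; positivity
  · exact Real.le_sqrt_of_sq_le <|
      single_le_sum (f := fun k => cycleDensity n k ^ 2) (fun _ _ => sq_nonneg _)
        (mem_range.2 (Nat.lt_succ_of_le h))

end Smoothing

section LowerDensity

open Equiv Equiv.Perm Filter Topology

/-- The proportion of the even permutations of `Fin n` that have fewer than `m` cycles. -/
noncomputable def evenLowerDensity (n m : ℕ) : ℝ :=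
  ({σ | σ ∈ alternatingGroup (Fin n) ∧ cycleCount σ < m} : Set (Perm (Fin n))).ncard /
    (Nat.card (alternatingGroup (Fin n)) : ℝ)

theorem evenLowerDensity_zero (n : ℕ) : evenLowerDensity n 0 = 0 := by
  simp [evenLowerDensity]

theorem evenLowerDensity_mono (n : ℕ) : Monotone (evenLowerDensity n) := fun a b hab => by
  unfold evenLowerDensity
  gcongr
  · exact Set.toFinite _

theorem evenLowerDensity_eq_one {n m : ℕ} (h : n < m) : evenLowerDensity n m = 1 := by
  have : ({σ | σ ∈ alternatingGroup (Fin n) ∧ cycleCount σ < m} : Set (Perm (Fin n))) =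
      alternatingGroup (Fin n) := by
    ext σ
    have hσ := cycleCount_le_card σ
    rw [Fintype.card_fin] at hσ
    simp only [Set.mem_ofPred_eq, SetLike.mem_coe, and_iff_left_iff_imp]
    omega
  rw [evenLowerDensity, this, ← Nat.card_coe_set_eq]
  exact div_self (by exact_mod_cast Nat.card_pos.ne')

theorem factorial_le_two_mul_card_alternatingGroup (n : ℕ) :
    n.factorial ≤ 2 * Nat.card (alternatingGroup (Fin n)) := by
  rcases lt_or_ge n 2 with h | h
  · have : 0 < Nat.card (alternatingGroup (Fin n)) := Nat.card_pos
    have := Nat.factorial_le h.le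
    rw [Nat.factorial_two] at this
    omega
  · have : Nontrivial (Fin n) := Fin.nontrivial_iff_two_le.2 h
    rw [two_mul_nat_card_alternatingGroup, Nat.card_perm, Nat.card_fin]

theorem evenLowerDensity_succ_le (n m : ℕ) :
    evenLowerDensity n (m + 1) ≤ evenLowerDensity n m + 2 * cycleDensity n m := by
  have hsub : ({σ | σ ∈ alternatingGroup (Fin n) ∧ cycleCount σ < m + 1} : Set (Perm (Fin n))) ⊆
      {σ | σ ∈ alternatingGroup (Fin n) ∧ cycleCount σ < m} ∪ {σ | cycleCount σ = m} := by
    rintro σ ⟨h1, h2⟩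
    rcases (Nat.lt_succ_iff.1 h2).lt_or_eq with h | h
    exacts [Or.inl ⟨h1, h⟩, Or.inr h]
  have hcard := (Set.ncard_le_ncard hsub).trans (Set.ncard_union_le _ _)
  have hfilter : ({σ | cycleCount σ = m} : Set (Perm (Fin n))).ncard =
      (Finset.univ.filter fun σ : Perm (Fin n) => cycleCount σ = m).card := by
    rw [← Set.ncard_coe_finset]; simp
  have hA : (0 : ℝ) < Nat.card (alternatingGroup (Fin n)) := by exact_mod_cast Nat.card_pos
  have hF : (0 : ℝ) < n.factorial := by exact_mod_cast n.factorial_pos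
  have hle : (n.factorial : ℝ) ≤ 2 * Nat.card (alternatingGroup (Fin n)) := by
    exact_mod_cast factorial_le_two_mul_card_alternatingGroup n
  have h2 : (({σ | cycleCount σ = m} : Set (Perm (Fin n))).ncard : ℝ) /
      Nat.card (alternatingGroup (Fin n)) ≤ 2 * cycleDensity n m := by
    rw [cycleDensity, hfilter, ← mul_div_assoc, div_le_div_iff₀ hA hF]
    nlinarith [mul_le_mul_of_nonneg_left hle (Nat.cast_nonneg (α := ℝ)
      (Finset.univ.filter fun σ : Perm (Fin n) => cycleCount σ = m).card)]
  refine le_trans ?_ (add_le_add_right h2 _)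
  rw [evenLowerDensity, evenLowerDensity, ← add_div]
  gcongr
  exact_mod_cast hcard

/-- An upper bound, tending to zero, for the jumps of `evenLowerDensity n`. -/
noncomputable def jumpBound (n : ℕ) : ℝ :=
  2 * √(∑ k ∈ Finset.range (n + 1), cycleDensity n k ^ 2)

theorem jumpBound_nonneg (n : ℕ) : 0 ≤ jumpBound n := by
  unfold jumpBound; positivity

theorem tendsto_jumpBound : Tendsto jumpBound atTop (𝓝 0) := by
  have h := (Real.continuous_sqrt.tendsto 0).comp tendsto_sum_sq_cycleDensity
  rw [Real.sqrt_zero] at h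
  exact (mul_zero (2 : ℝ)) ▸ h.const_mul 2

theorem evenLowerDensity_succ_le_add_jumpBound (n m : ℕ) :
    evenLowerDensity n (m + 1) ≤ evenLowerDensity n m + jumpBound n := by
  have := evenLowerDensity_succ_le n m
  have := cycleDensity_le_sqrt n m
  rw [jumpBound]
  linarith

/-- The largest threshold `m ≤ n + 1` with `evenLowerDensity n m ≤ x`. -/
noncomputable def densityThreshold (x : ℝ) (n : ℕ) : ℕ :=
  open Classical in Nat.findGreatest (fun m => evenLowerDensity n m ≤ x) (n + 1)

theorem densityThreshold_mono {x y : ℝ} (h : x ≤ y) (n : ℕ) :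
    densityThreshold x n ≤ densityThreshold y n := by
  classical
  exact Nat.findGreatest_mono (fun _ hm => le_trans hm h) le_rfl

theorem evenLowerDensity_densityThreshold_le {x : ℝ} (hx : 0 ≤ x) (n : ℕ) :
    evenLowerDensity n (densityThreshold x n) ≤ x := by
  classical
  exact Nat.findGreatest_spec (P := fun m => evenLowerDensity n m ≤ x) (Nat.zero_le (n + 1))
    ((evenLowerDensity_zero n).trans_le hx)

theorem le_evenLowerDensity_densityThreshold_add {x : ℝ} (hx : x ≤ 1) (n : ℕ) :
    x ≤ evenLowerDensity n (densityThreshold x n) + jumpBound n := by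
  classical
  rcases lt_or_ge n (densityThreshold x n) with h | h
  · rw [evenLowerDensity_eq_one h]
    linarith [jumpBound_nonneg n]
  · have : ¬ evenLowerDensity n (densityThreshold x n + 1) ≤ x :=
      Nat.findGreatest_is_greatest (P := fun m => evenLowerDensity n m ≤ x)
        (Nat.lt_succ_self _) (Nat.succ_le_succ h)
    exact (not_le.1 this).le.trans (evenLowerDensity_succ_le_add_jumpBound _ _)

theorem tendsto_evenLowerDensity_densityThreshold_add {x : ℝ} (hx0 : 0 ≤ x) (hx1 : x ≤ 1)
    (j : ℕ) :
    Tendsto (fun n => evenLowerDensity n (densityThreshold x n + j)) atTop (𝓝 x) := by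
  have hup (n m : ℕ) : evenLowerDensity n (m + j) ≤ evenLowerDensity n m + j * jumpBound n := by
    induction j with
    | zero => simp
    | succ j ih =>
      have := evenLowerDensity_succ_le_add_jumpBound n (m + j)
      rw [← add_assoc]
      push_cast
      linarith
  refine tendsto_of_tendsto_of_tendsto_of_le_of_le
    (g := fun n => x - jumpBound n) (h := fun n => x + j * jumpBound n) ?_ ?_ ?_ ?_
  · simpa using tendsto_jumpBound.const_sub x
  · simpa using (tendsto_jumpBound.const_mul (j : ℝ)).const_add x
  · intro n
    have := le_evenLowerDensity_densityThreshold_add hx1 n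
    have := evenLowerDensity_mono n (Nat.le_add_right (densityThreshold x n) j)
    dsimp only
    linarith
  · intro n
    have := evenLowerDensity_densityThreshold_le hx0 n
    have := hup n (densityThreshold x n)
    dsimp only
    linarith

theorem ncard_le_cycleCount_div (n m : ℕ) :
    (({σ | σ ∈ alternatingGroup (Fin n) ∧ m ≤ cycleCount σ} : Set (Perm (Fin n))).ncard : ℝ) /
      Nat.card (alternatingGroup (Fin n)) = 1 - evenLowerDensity n m := by
  have hA : (Nat.card (alternatingGroup (Fin n)) : ℝ) ≠ 0 := by exact_mod_cast Nat.card_pos.ne'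
  have hcard : ({σ | σ ∈ alternatingGroup (Fin n) ∧ m ≤ cycleCount σ} : Set (Perm (Fin n))).ncard +
      ({σ | σ ∈ alternatingGroup (Fin n) ∧ cycleCount σ < m} : Set (Perm (Fin n))).ncard =
      Nat.card (alternatingGroup (Fin n)) := by
    rw [← Set.ncard_union_eq
      (Set.disjoint_left.2 fun σ h h' => (Nat.not_lt.2 h.2) h'.2), ← SetLike.coe_sort_coe,
      Nat.card_coe_set_eq]
    congr 1
    ext σ
    simp only [Set.mem_union, Set.mem_ofPred_eq, SetLike.mem_coe, ← and_or_left]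
    exact and_iff_left (le_or_gt _ _)
  rw [evenLowerDensity, eq_sub_iff_add_eq, ← add_div, div_eq_one_iff_eq hA]
  exact_mod_cast hcard

end LowerDensity

theorem Subgroup.mul_eq_of_card_lt_card_add_card {G : Type*} [Group G] [Finite G] (H : Subgroup G)
    {S T : Set G} (hS : S ⊆ H) (hT : T ⊆ H) (h : Nat.card H < Nat.card S + Nat.card T) :
    S * T = H := by
  refine Set.Subset.antisymm ?_ fun g hg => ?_
  · rintro _ ⟨x, hx, y, hy, rfl⟩
    exact H.mul_mem (hS hx) (hT hy)
  · let U : Set G := Set.image (fun y => g * y⁻¹) T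
    have hU : U ⊆ H := by
      rintro _ ⟨y, hy, rfl⟩
      exact H.mul_mem hg (H.inv_mem (hT hy))
    have hinj : Function.Injective fun y : G => g * y⁻¹ := fun a b hab => by simpa using hab
    have hUc : U.ncard = T.ncard := Set.ncard_image_of_injective T hinj
    have hne : (S ∩ U).Nonempty := by
      rw [Set.nonempty_iff_ne_empty]
      intro he
      have h1 := Set.ncard_union_eq (Set.disjoint_iff_inter_eq_empty.2 he)
      have h2 := Set.ncard_le_ncard (Set.union_subset hS hU)
      simp only [← SetLike.coe_sort_coe, Nat.card_coe_set_eq] at h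
      omega
    obtain ⟨x, hx, y, hy, hxy⟩ := hne
    exact ⟨x, hx, y, hy, by simp [← hxy]⟩

open Pointwise

/-- (i) if `s + t ≤ 1` there are normal subsets `S_n, T_n ⊆ A_n`
with `|S_n|/|A_n| → s`, `|T_n|/|A_n| → t` and no 3-cycle in any `S_n T_n`;
(ii) if `s + t > 1`, any such sequences satisfy `S_n T_n = A_n` eventually. -/
theorem stmt_9 (s t : ℝ) (hs0 : 0 ≤ s) (hs1 : s ≤ 1) (ht0 : 0 ≤ t) (ht1 : t ≤ 1) :
    (s + t ≤ 1 →
      ∃ S T : (n : ℕ) → Set (Equiv.Perm (Fin n)),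
        (∀ n, S n ⊆ (alternatingGroup (Fin n) : Set (Equiv.Perm (Fin n)))) ∧
        (∀ n, T n ⊆ (alternatingGroup (Fin n) : Set (Equiv.Perm (Fin n)))) ∧
        (∀ n, ∀ g ∈ alternatingGroup (Fin n), ∀ x ∈ S n, g * x * g⁻¹ ∈ S n) ∧
        (∀ n, ∀ g ∈ alternatingGroup (Fin n), ∀ x ∈ T n, g * x * g⁻¹ ∈ T n) ∧
        Filter.Tendsto
          (fun n => (Nat.card (S n) : ℝ) / (Nat.card (alternatingGroup (Fin n)) : ℝ))
          Filter.atTop (nhds s) ∧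
        Filter.Tendsto
          (fun n => (Nat.card (T n) : ℝ) / (Nat.card (alternatingGroup (Fin n)) : ℝ))
          Filter.atTop (nhds t) ∧
        (∀ n, ∀ x ∈ S n * T n, ¬ Equiv.Perm.IsThreeCycle x)) ∧
    (1 < s + t →
      ∀ S T : (n : ℕ) → Set (Equiv.Perm (Fin n)),
        (∀ n, S n ⊆ (alternatingGroup (Fin n) : Set (Equiv.Perm (Fin n)))) →
        (∀ n, T n ⊆ (alternatingGroup (Fin n) : Set (Equiv.Perm (Fin n)))) →
        Filter.Tendsto
          (fun n => (Nat.card (S n) : ℝ) / (Nat.card (alternatingGroup (Fin n)) : ℝ))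
          Filter.atTop (nhds s) →
        Filter.Tendsto
          (fun n => (Nat.card (T n) : ℝ) / (Nat.card (alternatingGroup (Fin n)) : ℝ))
          Filter.atTop (nhds t) →
        ∃ N : ℕ, ∀ n, N ≤ n →
          S n * T n = (alternatingGroup (Fin n) : Set (Equiv.Perm (Fin n)))) := by
  refine ⟨fun hst => ?_, fun hst S T hS hT hSlim hTlim => ?_⟩
  · refine ⟨fun n => {σ | σ ∈ alternatingGroup (Fin n) ∧ cycleCount σ < densityThreshold s n},
      fun n => {σ | σ ∈ alternatingGroup (Fin n) ∧ densityThreshold (1 - t) n + 2 ≤ cycleCount σ},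
      fun n σ hσ => hσ.1, fun n σ hσ => hσ.1, fun n g hg σ hσ => ?_, fun n g hg σ hσ => ?_,
      ?_, ?_, ?_⟩
    · exact ⟨mul_mem (mul_mem hg hσ.1) (inv_mem hg), (cycleCount_conj g σ).trans_lt hσ.2⟩
    · exact ⟨mul_mem (mul_mem hg hσ.1) (inv_mem hg), hσ.2.trans_eq (cycleCount_conj g σ).symm⟩
    · exact tendsto_evenLowerDensity_densityThreshold_add hs0 hs1 0
    · have h := (tendsto_evenLowerDensity_densityThreshold_add (x := 1 - t) (by linarith)
        (by linarith) 2).const_sub 1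
      rw [sub_sub_cancel] at h
      exact h.congr fun n => (ncard_le_cycleCount_div n _).symm
    · rintro n _ ⟨x, hx, y, hy, rfl⟩ hxy
      have h := cycleCount_le_cycleCount_mul_add_two y hxy.inv
      have hle := densityThreshold_mono (show s ≤ 1 - t by linarith) n
      have hx' := hx.2
      have hy' := hy.2
      simp only [mul_inv_rev, mul_inv_cancel_left, cycleCount_inv] at h
      omega
  · obtain ⟨N, hN⟩ := Filter.eventually_atTop.1
      ((hSlim.add hTlim).eventually_const_lt hst)
    refine ⟨N, fun n hn => Subgroup.mul_eq_of_card_lt_card_add_card _ (hS n) (hT n) ?_⟩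
    have h := hN n hn
    rw [← add_div, one_lt_div (by exact_mod_cast Nat.card_pos)] at h
    exact_mod_cast h
end

section
/- Let Ω be a finite set and let G be a subgroup of the symmetric group Sym(Ω) acting transitively on Ω. Suppose G is isomorphic (as a group) to the alternating group A_n for some n ≥ 5. Then every element of G is a product of two derangements, i.e. for every g ∈ G there exist d₁, d₂ ∈ G, each fixing no point of Ω, with g = d₁d₂. -/
namespace AltDerangement

open Equiv Equiv.Perm Finset

section

variable {α : Type*}

/-- `f` permutes the finite set `B` in a single cycle and fixes every other point. -/
def CycOn (f : Perm α) (B : Finset α) : Prop :=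
  (∀ x, x ∉ B → f x = x) ∧ ∀ x ∈ B, ∀ y ∈ B, f.SameCycle x y

theorem apply_mem_of_fixes {f : Perm α} {B : Finset α} (h : ∀ x, x ∉ B → f x = x) {x : α}
    (hx : x ∈ B) : f x ∈ B := by
  by_contra hc
  exact hc (by rwa [f.injective (h _ hc)])

namespace CycOn

variable {f g : Perm α} {B C : Finset α} {a : α}

theorem isCycleOn (h : CycOn f B) : f.IsCycleOn B := by
  refine ⟨⟨fun x hx => apply_mem_of_fixes h.1 hx, f.injective.injOn, fun x hx => ?_⟩, h.2⟩
  refine ⟨f⁻¹ x, ?_, by simp⟩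
  have : ∀ x, x ∉ B → f⁻¹ x = x := fun x hx => by
    rw [Perm.inv_eq_iff_eq]; exact (h.1 x hx).symm
  exact apply_mem_of_fixes this hx

theorem of_base (h1 : ∀ x, x ∉ B → f x = x) (h2 : ∀ x ∈ B, f.SameCycle a x) :
    CycOn f B :=
  ⟨h1, fun _ hx _ hy => (h2 _ hx).symm.trans (h2 _ hy)⟩

theorem exists_pow (h : CycOn f B) {x y : α} (hx : x ∈ B) (hy : y ∈ B) :
    ∃ n : ℕ, (f ^ n) x = y :=
  let ⟨n, _, hn⟩ := h.isCycleOn.exists_pow_eq hx hy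
  ⟨n, hn⟩

theorem inv (h : CycOn f B) : CycOn f⁻¹ B :=
  ⟨fun x hx => by rw [Perm.inv_eq_iff_eq]; exact (h.1 x hx).symm,
    fun x hx y hy => (h.2 x hx y hy).inv⟩

theorem pow_card (h : CycOn f B) : f ^ #B = 1 := by
  ext x
  by_cases hx : x ∈ B
  · simpa using h.isCycleOn.pow_card_apply hx
  · exact Function.IsFixedPt.perm_pow (h.1 x hx) _

variable [DecidableEq α]

theorem mul (hf : CycOn f B) (hg : CycOn g C) (h : B ∩ C = {a}) : CycOn (f * g) (B ∪ C) := by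
  have haB : a ∈ B := (mem_inter.1 (h ▸ mem_singleton_self a)).1
  have haC : a ∈ C := (mem_inter.1 (h ▸ mem_singleton_self a)).2
  have key : ∀ {x}, x ∈ B → x ∈ C → x = a := fun hB hC =>
    mem_singleton.1 (h ▸ mem_inter.2 ⟨hB, hC⟩)
  have gC : ∀ j : ℕ, (g ^ j) a ∈ C := fun j => by
    induction j with
    | zero => simpa
    | succ j ih => rw [pow_succ', Perm.mul_apply]; exact apply_mem_of_fixes hg.1 ih
  have fB : ∀ j : ℕ, (f ^ j) a ∈ B := fun j => by
    induction j with
    | zero => simpa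
    | succ j ih => rw [pow_succ', Perm.mul_apply]; exact apply_mem_of_fixes hf.1 ih
  have h1 : ∀ x ∈ C, (f * g).SameCycle a x := by
    intro x hx
    obtain ⟨n, rfl⟩ := hg.exists_pow haC hx
    clear hx
    induction n with
    | zero => exact SameCycle.refl _ _
    | succ j ih =>
      by_cases hc : (g ^ (j + 1)) a = a
      · rw [hc]
      · have : (f * g) ((g ^ j) a) = (g ^ (j + 1)) a := by
          rw [Perm.mul_apply, ← Perm.mul_apply g, ← pow_succ']
          exact hf.1 _ fun hB => hc (key hB (gC _))
        rw [← this]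
        exact sameCycle_apply_right.2 ih
  have h2 : ∀ x ∈ B, (f * g).SameCycle a x := by
    intro x hx
    obtain ⟨n, rfl⟩ := hf.exists_pow haB hx
    clear hx
    induction n with
    | zero => exact SameCycle.refl _ _
    | succ j ih =>
      rw [pow_succ', Perm.mul_apply]
      by_cases hc : (f ^ j) a = a
      · rw [hc]
        have h3 : g⁻¹ a ∈ C := apply_mem_of_fixes hg.inv.1 haC
        have : f a = (f * g) (g⁻¹ a) := by simp
        rw [this]
        exact sameCycle_apply_right.2 (h1 _ h3)
      · have : f ((f ^ j) a) = (f * g) ((f ^ j) a) := by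
          rw [Perm.mul_apply, hg.1 _ fun hC => hc (key (fB _) hC)]
        rw [this]
        exact sameCycle_apply_right.2 ih
  refine of_base (a := a) (fun x hx => ?_) fun x hx => ?_
  · rw [mem_union, not_or] at hx
    rw [Perm.mul_apply, hg.1 x hx.2, hf.1 x hx.1]
  · exact (mem_union.1 hx).elim (h2 x) (h1 x)

theorem swap {a b : α} (hab : a ≠ b) : CycOn (Equiv.swap a b) {a, b} := by
  refine of_base (a := a) (fun x hx => ?_) fun x hx => ?_
  · simp only [mem_insert, mem_singleton, not_or] at hx
    exact swap_apply_of_ne_of_ne hx.1 hx.2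
  · rcases mem_insert.1 hx with rfl | hx
    · exact SameCycle.refl _ _
    · rw [mem_singleton.1 hx]
      exact ⟨1, by simp⟩

/-- Appending a new point after multiplication by a transposition on the right. -/
theorem mul_swap {z : α} (hf : CycOn f B) (ha : a ∈ B) (hz : z ∉ B) :
    CycOn (f * Equiv.swap z a) (insert z B) := by
  have hza : z ≠ a := fun h => hz (h ▸ ha)
  have := hf.mul (a := a) (swap hza) (by ext x; simp; grind)
  convert this using 1
  ext x; simp; grind

/-- Appending a new point after multiplication by a transposition on the left. -/
theorem swap_mul {z : α} (hf : CycOn f B) (ha : a ∈ B) (hz : z ∉ B) :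
    CycOn (Equiv.swap z a * f) (insert z B) := by
  have := (hf.inv.mul_swap ha hz).inv
  simpa using this

theorem sign_eq [Fintype α] (h : CycOn f B) (hB : B.Nonempty) :
    sign f = (-1) ^ (#B + 1) := by
  by_cases hn : B.Nontrivial
  · have hs : f.support = B := by
      ext x
      refine ⟨fun hx => ?_, fun hx => ?_⟩
      · by_contra hc
        exact mem_support.1 hx (h.1 x hc)
      · exact mem_support.2 (h.isCycleOn.apply_ne (by simpa using hn) hx)
    have hc : f.IsCycle := isCycle_iff_exists_isCycleOn.2
      ⟨B, by simpa using hn, h.isCycleOn, fun x hx => by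
        by_contra hc
        exact hx (h.1 x hc)⟩
    rw [hc.sign, hs, pow_succ, mul_neg_one]
  · obtain ⟨x, hx⟩ := hB
    have hBx : B = {x} := by
      rw [eq_singleton_iff_unique_mem]
      refine ⟨hx, fun y hy => ?_⟩
      by_contra hc
      exact hn ⟨y, hy, x, hx, hc⟩
    subst hBx
    have : f = 1 := by
      ext y
      by_cases hy : y = x
      · subst hy
        simpa using apply_mem_of_fixes h.1 hx
      · exact h.1 y (by simpa using hy)
    simp [this]

end CycOn

theorem exists_cycOn [Fintype α] [DecidableEq α] (B : Finset α) : ∃ f : Perm α, CycOn f B := by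
  obtain ⟨f, hf, hs⟩ := B.exists_cycleOn
  exact ⟨f, fun x hx => by
    by_contra hc
    exact hx (hs (by simpa using hc)), fun x hx y hy => hf.2 hx hy⟩

/-- `h` is the product of cycles on subsets of `s` with `k₁` and `k₂` points missing from `s`,
both of which pass through `a`. -/
def Splits (s : Finset α) (h : Perm α) (a : α) (k₁ k₂ : ℕ) : Prop :=
  ∃ (c₁ c₂ : Perm α) (B₁ B₂ : Finset α), CycOn c₁ B₁ ∧ CycOn c₂ B₂ ∧ B₁ ⊆ s ∧ B₂ ⊆ s ∧
    a ∈ B₁ ∧ a ∈ B₂ ∧ #B₁ + k₁ = #s ∧ #B₂ + k₂ = #s ∧ h = c₁ * c₂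

variable [DecidableEq α]

theorem Splits.of_erase_fixed {s : Finset α} {h : Perm α} {a b : α} {k₁ k₂ : ℕ} (ha : a ∈ s)
    (H : Splits (s.erase a) h b k₁ k₂) : Splits s h a k₁ k₂ := by
  obtain ⟨c₁, c₂, B₁, B₂, h1, h2, hs1, hs2, hb1, hb2, e1, e2, rfl⟩ := H
  have n1 : a ∉ B₁ := fun h => by simpa using hs1 h
  have n2 : a ∉ B₂ := fun h => by simpa using hs2 h
  have hc := card_erase_add_one ha
  refine ⟨c₁ * swap a b, swap a b * c₂, insert a B₁, insert a B₂, h1.mul_swap hb1 n1,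
    h2.swap_mul hb2 n2, ?_, ?_, by simp, by simp, ?_, ?_, ?_⟩
  · exact insert_subset ha (hs1.trans (erase_subset _ _))
  · exact insert_subset ha (hs2.trans (erase_subset _ _))
  · rw [card_insert_of_notMem n1]; omega
  · rw [card_insert_of_notMem n2]; omega
  · simp [mul_assoc]

theorem Splits.of_erase_right {s : Finset α} {h : Perm α} {a z : α} {k₁ k₂ : ℕ} (hz : z ∈ s)
    (H : Splits (s.erase z) (h * swap z a) a k₁ k₂) : Splits s h a (k₁ + 1) k₂ := by
  obtain ⟨c₁, c₂, B₁, B₂, h1, h2, hs1, hs2, hb1, hb2, e1, e2, hh⟩ := H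
  have n2 : z ∉ B₂ := fun h => by simpa using hs2 h
  have hc := card_erase_add_one hz
  refine ⟨c₁, c₂ * swap z a, B₁, insert z B₂, h1, h2.mul_swap hb2 n2, ?_, ?_, hb1, by simp [hb2],
    by omega, ?_, ?_⟩
  · exact hs1.trans (erase_subset _ _)
  · exact insert_subset hz (hs2.trans (erase_subset _ _))
  · rw [card_insert_of_notMem n2]; omega
  · rw [← mul_assoc, ← hh]; simp [mul_assoc]

theorem Splits.of_erase_left {s : Finset α} {h : Perm α} {a z : α} {k₁ k₂ : ℕ} (hz : z ∈ s)
    (H : Splits (s.erase z) (swap z a * h) a k₁ k₂) : Splits s h a k₁ (k₂ + 1) := by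
  obtain ⟨c₁, c₂, B₁, B₂, h1, h2, hs1, hs2, hb1, hb2, e1, e2, hh⟩ := H
  have n1 : z ∉ B₁ := fun h => by simpa using hs1 h
  have hc := card_erase_add_one hz
  refine ⟨swap z a * c₁, c₂, insert z B₁, B₂, h1.swap_mul hb1 n1, h2, ?_, ?_, by simp [hb1], hb2,
    ?_, by omega, ?_⟩
  · exact insert_subset hz (hs1.trans (erase_subset _ _))
  · exact hs2.trans (erase_subset _ _)
  · rw [card_insert_of_notMem n1]; omega
  · rw [mul_assoc, ← hh]; simp [← mul_assoc]

theorem Splits.of_erase_full {s : Finset α} {h : Perm α} {a z : α} (hz : z ∈ s)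
    (H : Splits (s.erase z) (h * swap z a) a 0 1) : Splits s h a 0 0 := by
  obtain ⟨c₁, c₂, B₁, B₂, h1, h2, hs1, hs2, hb1, hb2, e1, e2, hh⟩ := H
  have n1 : z ∉ B₁ := fun h => by simpa using hs1 h
  have n2 : z ∉ B₂ := fun h => by simpa using hs2 h
  have hc := card_erase_add_one hz
  have hB1 : B₁ = s.erase z := eq_of_subset_of_card_le hs1 (by omega)
  obtain ⟨q, hq, hq2⟩ : ∃ q ∈ s.erase z, q ∉ B₂ := by
    by_contra! hcon
    have := card_le_card (fun x hx => hcon x hx : s.erase z ⊆ B₂)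
    omega
  have hqz : q ≠ z := (mem_erase.1 hq).1
  refine ⟨c₁ * swap z q, swap q z * (c₂ * swap z a), insert z B₁, insert q (insert z B₂),
    h1.mul_swap (hB1 ▸ hq) n1, (h2.mul_swap hb2 n2).swap_mul (mem_insert_self _ _) ?_,
    ?_, ?_, by simp [hb1], by simp [hb2], ?_, ?_, ?_⟩
  · simp [hqz, hq2]
  · exact insert_subset hz (hs1.trans (erase_subset _ _))
  · exact insert_subset (mem_erase.1 hq).2 (insert_subset hz (hs2.trans (erase_subset _ _)))
  · rw [card_insert_of_notMem n1]; omega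
  · rw [card_insert_of_notMem (by simp [hqz, hq2]), card_insert_of_notMem n2]; omega
  · have : c₁ * swap z q * (swap q z * (c₂ * swap z a)) = c₁ * c₂ * swap z a := by
      rw [swap_comm q z]; simp [mul_assoc]
    rw [this, ← hh]; simp [mul_assoc]

theorem splits_aux [Fintype α] (m : ℕ) : ∀ (s : Finset α) (h : Perm α) (a : α) (k : ℕ), #s = m →
    a ∈ s → (∀ x, x ∉ s → h x = x) →
    (sign h = 1 → (4 * k ≤ m + 2 ∨ h a ≠ a ∧ 4 * k ≤ m + 3) → Splits s h a k k) ∧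
    (sign h = -1 → (4 * k ≤ m ∨ h a ≠ a ∧ 4 * k ≤ m + 1) → Splits s h a k (k + 1)) := by
  induction m with
  | zero =>
    intro s h a k hs ha
    rw [card_eq_zero.1 hs] at ha
    simp at ha
  | succ m ih =>
    intro s h a k hs ha hfix
    have hmem : ∀ {x}, h x ≠ x → x ∈ s := fun {x} hx => by
      by_contra hc; exact hx (hfix x hc)
    have step (hh : h ≠ 1) (hfa : h a = a) : ∃ b ∈ s.erase a, h b ≠ b ∧
        ∀ x, x ∉ s.erase a → h x = x := by
      obtain ⟨b, hb⟩ : ∃ b, h b ≠ b := by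
        by_contra! hc; exact hh (Perm.ext hc)
      refine ⟨b, mem_erase.2 ⟨fun h => hb (h ▸ hfa), hmem hb⟩, hb, fun x hx => ?_⟩
      by_cases hxa : x = a
      · rw [hxa, hfa]
      · exact hfix x fun hxs => hx (mem_erase.2 ⟨hxa, hxs⟩)
    have hm : m = #s - 1 := by omega
    have right (hfa : h a ≠ a) : h a ∈ s ∧ a ∈ s.erase (h a) ∧ (∀ x, x ∉ s.erase (h a) →
        (h * swap (h a) a) x = x) ∧ sign (h * swap (h a) a) = - sign h := by
      refine ⟨apply_mem_of_fixes hfix ha, mem_erase.2 ⟨hfa.symm, ha⟩, fun x hx => ?_, ?_⟩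
      · by_cases hxa : x = h a
        · simp [hxa]
        · have hxs : x ∉ s := fun hxs => hx (mem_erase.2 ⟨hxa, hxs⟩)
          have hx' : x ≠ a := fun h => hxs (h ▸ ha)
          simp [swap_apply_of_ne_of_ne hxa hx', hfix x hxs]
      · simp [sign_swap hfa]
    have left (hfa : h a ≠ a) : h⁻¹ a ∈ s ∧ a ∈ s.erase (h⁻¹ a) ∧ (∀ x, x ∉ s.erase (h⁻¹ a) →
        (swap (h⁻¹ a) a * h) x = x) ∧ sign (swap (h⁻¹ a) a * h) = - sign h := by
      have hia : h⁻¹ a ≠ a := fun hc => hfa (by rw [Perm.inv_eq_iff_eq] at hc; exact hc.symm)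
      have hfix' : ∀ x, x ∉ s → h⁻¹ x = x := fun x hx => by
        rw [Perm.inv_eq_iff_eq]; exact (hfix x hx).symm
      refine ⟨apply_mem_of_fixes hfix' ha, mem_erase.2 ⟨hia.symm, ha⟩, fun x hx => ?_, ?_⟩
      · by_cases hxa : x = h⁻¹ a
        · simp [hxa]
        · have hxs : x ∉ s := fun hxs => hx (mem_erase.2 ⟨hxa, hxs⟩)
          have hx' : x ≠ a := fun h => hxs (h ▸ ha)
          rw [Perm.mul_apply, hfix x hxs, swap_apply_of_ne_of_ne hxa hx']
      · rw [Perm.sign_mul, sign_swap hia, neg_one_mul]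
    constructor
    · intro hsgn hk
      by_cases hh : h = 1
      · subst hh
        obtain ⟨B, hB1, hB2, hB3⟩ := exists_subsuperset_card_eq (s := {a}) (t := s)
          (n := m + 1 - k) (by simpa using ha) (by simp at hk ⊢; omega) (by omega)
        obtain ⟨c, hc⟩ := exists_cycOn B
        have haB : a ∈ B := hB1 (by simp)
        exact ⟨c, c⁻¹, B, B, hc, hc.inv, hB2, hB2, haB, haB, by simp at hk; omega,
          by simp at hk; omega, by simp⟩
      by_cases hfa : h a = a
      · obtain ⟨b, hb, hb1, hb2⟩ := step hh hfa
        exact Splits.of_erase_fixed ha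
          ((ih _ h b k (by rw [card_erase_of_mem ha, hs]; rfl) hb hb2).1 hsgn
            (Or.inr ⟨hb1, by simp [hfa] at hk; omega⟩))
      · obtain ⟨hz, ha', hf', hs'⟩ := right hfa
        rw [hsgn] at hs'
        have hc' : #(s.erase (h a)) = m := by rw [card_erase_of_mem hz, hs]; rfl
        have hm1 : 1 ≤ m := hc' ▸ card_pos.2 ⟨a, ha'⟩
        cases k with
        | zero =>
          exact Splits.of_erase_full hz ((ih _ _ a 0 hc' ha' hf').2 hs' (Or.inl (by omega)))
        | succ k =>
          exact Splits.of_erase_right hz ((ih _ _ a k hc' ha' hf').2 hs' (Or.inl (by omega)))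
    · intro hsgn hk
      have hh : h ≠ 1 := by rintro rfl; simp at hsgn
      by_cases hfa : h a = a
      · obtain ⟨b, hb, hb1, hb2⟩ := step hh hfa
        exact Splits.of_erase_fixed ha
          ((ih _ h b k (by rw [card_erase_of_mem ha, hs]; rfl) hb hb2).2 hsgn
            (Or.inr ⟨hb1, by simp [hfa] at hk; omega⟩))
      · obtain ⟨hz, ha', hf', hs'⟩ := left hfa
        rw [hsgn] at hs'
        have hc' : #(s.erase (h⁻¹ a)) = m := by rw [card_erase_of_mem hz, hs]; rfl
        exact Splits.of_erase_left hz ((ih _ _ a k hc' ha' hf').1 (by simpa using hs')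
          (Or.inl (by omega)))

/-- An even permutation of `s` is a product of two cycles through a prescribed point, each missing
exactly `k` points of `s`, provided that `k` is at most about a quarter of the size of `s`. -/
theorem splits [Fintype α] {s : Finset α} {h : Perm α} {a : α} (k : ℕ) (ha : a ∈ s)
    (hfix : ∀ x, x ∉ s → h x = x) (hsgn : sign h = 1)
    (hk : 4 * k ≤ #s + 2 ∨ h a ≠ a ∧ 4 * k ≤ #s + 3) : Splits s h a k k :=
  (splits_aux _ s h a k rfl ha hfix).1 hsgn hk

end

section

variable {α : Type*}

/-- A permutation of `Fin r` supported on three points together with a cycle on the rest. -/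
def IsBase {r : ℕ} (z b : Perm (Fin r)) : Prop :=
  #z.support = 3 ∧ (∀ x, z x ≠ x → b x = x) ∧
    ∀ x, z x = x → ∀ y, z y = y → ∃ i : Fin r, b^[i] x = y

instance {r : ℕ} (z b : Perm (Fin r)) : Decidable (IsBase z b) := by
  unfold IsBase; infer_instance

theorem IsBase.cycOn {r : ℕ} {z b : Perm (Fin r)} (h : IsBase z b) : CycOn b z.supportᶜ := by
  refine ⟨fun x hx => h.2.1 x (by simpa using hx), fun x hx y hy => ?_⟩
  obtain ⟨i, hi⟩ := h.2.2 x (by simpa using hx) y (by simpa using hy)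
  exact ⟨(i : ℕ), by rw [zpow_natCast, ← iterate_eq_pow, hi]⟩

section embedding

variable {r : ℕ} (e : Fin r ↪ α)

theorem CycOn.viaEmbedding {b : Perm (Fin r)} {B : Finset (Fin r)} (h : CycOn b B) :
    CycOn (viaEmbeddingHom e b) (B.map e) := by
  have hp (j : ℕ) (x : Fin r) : (viaEmbeddingHom e b ^ j) (e x) = e ((b ^ j) x) := by
    rw [← map_pow, viaEmbeddingHom_apply, viaEmbedding_apply]
  refine ⟨fun x hx => ?_, fun x hx y hy => ?_⟩
  · rw [viaEmbeddingHom_apply]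
    by_cases hr : x ∈ Set.range e
    · obtain ⟨y, rfl⟩ := hr
      rw [viaEmbedding_apply, h.1 y fun hy => hx (mem_map_of_mem _ hy)]
    · exact viaEmbedding_apply_of_notMem _ _ _ hr
  · obtain ⟨x, hx', rfl⟩ := mem_map.1 hx
    obtain ⟨y, hy', rfl⟩ := mem_map.1 hy
    obtain ⟨j, rfl⟩ := h.exists_pow hx' hy'
    exact ⟨(j : ℕ), by rw [zpow_natCast, hp]⟩

variable [Fintype α] [DecidableEq α]

theorem support_viaEmbeddingHom (z : Perm (Fin r)) :
    (viaEmbeddingHom e z).support = z.support.map e := by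
  ext x
  rw [mem_support, viaEmbeddingHom_apply]
  by_cases hr : x ∈ Set.range e
  · obtain ⟨y, rfl⟩ := hr
    simp [viaEmbedding_apply]
  · rw [viaEmbedding_apply_of_notMem _ _ _ hr]
    simp only [ne_eq, not_true_eq_false, mem_map, false_iff]
    rintro ⟨y, -, rfl⟩
    exact hr ⟨y, rfl⟩

theorem isThreeCycle_viaEmbeddingHom {z : Perm (Fin r)} (h : #z.support = 3) :
    (viaEmbeddingHom e z).IsThreeCycle := by
  rw [← card_support_eq_three_iff, support_viaEmbeddingHom, card_map, h]

end embedding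

variable [Fintype α] [DecidableEq α]

/-- Products of a three-cycle on `s` and a disjoint cycle on `s` missing exactly `k` of the
remaining points of `s`. -/
def Good (k : ℕ) (s : Finset α) (d : Perm α) : Prop :=
  ∃ (z t : Perm α) (B : Finset α), z.IsThreeCycle ∧ z.support ⊆ s ∧ B ⊆ s ∧
    _root_.Disjoint z.support B ∧ CycOn t B ∧ #B + 3 + k = #s ∧ d = z * t

theorem support_subset_of_cycOn {t : Perm α} {B : Finset α} (h : CycOn t B) : t.support ⊆ B := by
  intro x hx
  by_contra hc
  exact mem_support.1 hx (h.1 x hc)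

theorem good_of_split {r : ℕ} (e : Fin r ↪ α) {z b : Perm (Fin r)} {a : Fin r} (h : IsBase z b)
    (ha : z a = a) {s C : Finset α} (hes : ∀ y, e y ∈ s) {c : Perm α} (hc : CycOn c C)
    (hC : C ⊆ insert (e a) (s \ univ.map e)) (haC : e a ∈ C) {k : ℕ}
    (hk : #C + k = #(insert (e a) (s \ univ.map e))) {t : Perm α}
    (ht : t = viaEmbeddingHom e b * c ∨ t = c * viaEmbeddingHom e b) :
    Good k s (viaEmbeddingHom e z * t) ∧ Commute (viaEmbeddingHom e z) t := by
  have hmem : a ∈ z.supportᶜ := by simpa using ha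
  have hBC : (z.supportᶜ).map e ∩ C = {e a} := by
    ext x
    simp only [mem_inter, mem_singleton]
    constructor
    · rintro ⟨hx, hxC⟩
      rcases mem_insert.1 (hC hxC) with h | h
      · exact h
      · obtain ⟨y, -, rfl⟩ := mem_map.1 hx
        simp at h
    · rintro rfl
      exact ⟨mem_map_of_mem _ hmem, haC⟩
  have hcyc : CycOn t ((z.supportᶜ).map e ∪ C) := by
    rcases ht with rfl | rfl
    · exact (h.cycOn.viaEmbedding e).mul hc hBC
    · rw [union_comm]
      exact hc.mul (h.cycOn.viaEmbedding e) (by rw [inter_comm, hBC])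
  have hCs : C ⊆ s := hC.trans (insert_subset (hes a) sdiff_subset)
  have hdis : _root_.Disjoint (viaEmbeddingHom e z).support ((z.supportᶜ).map e ∪ C) := by
    rw [support_viaEmbeddingHom, disjoint_union_right]
    refine ⟨by rw [disjoint_map]; exact disjoint_compl_right, ?_⟩
    rw [Finset.disjoint_left]
    intro x hx hxC
    obtain ⟨y, hy, rfl⟩ := mem_map.1 hx
    rcases mem_insert.1 (hC hxC) with h | h
    · rw [e.injective h, mem_support] at hy
      exact hy ha
    · simp at h
  refine ⟨⟨_, t, _, isThreeCycle_viaEmbeddingHom e h.1, ?_, ?_, hdis, hcyc, ?_, rfl⟩, ?_⟩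
  · rw [support_viaEmbeddingHom]
    intro x hx
    obtain ⟨y, -, rfl⟩ := mem_map.1 hx
    exact hes y
  · refine union_subset (fun x hx => ?_) hCs
    obtain ⟨y, -, rfl⟩ := mem_map.1 hx
    exact hes y
  · have h1 := card_union_add_card_inter ((z.supportᶜ).map e) C
    rw [hBC, card_singleton, card_map, card_compl, h.1, Fintype.card_fin] at h1
    have h3 : 3 ≤ r := by
      have := card_le_univ z.support
      rw [h.1, Fintype.card_fin] at this; exact this
    have h2 : #(insert (e a) (s \ univ.map e)) + r = #s + 1 := by
      rw [card_insert_of_notMem (by simp), card_sdiff_of_subset (fun x hx => by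
        obtain ⟨y, -, rfl⟩ := mem_map.1 hx
        exact hes y), card_map, card_univ, Fintype.card_fin]
      have : #(univ.map e) ≤ #s := card_le_card fun x hx => by
        obtain ⟨y, -, rfl⟩ := mem_map.1 hx
        exact hes y
      rw [card_map, card_univ, Fintype.card_fin] at this
      omega
    omega
  · apply Equiv.Perm.Disjoint.commute
    rw [disjoint_iff_disjoint_support]
    exact Finset.disjoint_of_subset_right (support_subset_of_cycOn hcyc) hdis

/-- `g` is a product of two elements of shape `Good k s`. -/
def GoodProd (k : ℕ) (s : Finset α) (g : Perm α) : Prop :=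
  ∃ d₁ d₂, Good k s d₁ ∧ Good k s d₂ ∧ g = d₁ * d₂

theorem sign_viaEmbeddingHom_of_isBase {r : ℕ} (e : Fin r ↪ α) {z b : Perm (Fin r)}
    {a : Fin r} (h : IsBase z b) (ha : z a = a) :
    sign (viaEmbeddingHom e (z * b)) = (-1) ^ r := by
  have h3 : 3 ≤ r := by
    have := card_le_univ z.support
    rw [h.1, Fintype.card_fin] at this; exact this
  have hmem : a ∈ z.supportᶜ := by simpa using ha
  rw [map_mul, map_mul, (isThreeCycle_viaEmbeddingHom e h.1).sign,
    (h.cycOn.viaEmbedding e).sign_eq ⟨_, mem_map_of_mem _ hmem⟩, card_map, card_compl, h.1,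
    Fintype.card_fin, one_mul]
  obtain ⟨m, rfl⟩ := Nat.exists_eq_add_of_le h3
  rw [show 3 + m - 3 + 1 = m + 1 by omega, show 3 + m = (m + 1) + 2 by omega,
    pow_add _ (m + 1) 2]
  simp

theorem goodProd_of_graft {r : ℕ} (e : Fin r ↪ α) {z₁ b₁ z₂ b₂ : Perm (Fin r)} {a : Fin r}
    (h₁ : IsBase z₁ b₁) (h₂ : IsBase z₂ b₂) (ha₁ : z₁ a = a) (ha₂ : z₂ a = a)
    {s : Finset α} {g : Perm α} (hes : ∀ y, e y ∈ s) (hg : ∀ x, x ∉ s → g x = x)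
    (hsgn : sign g = 1)
    (hbase : ∀ y, b₂ (z₂ y) ≠ a → g (e y) = e (z₁ (b₁ (b₂ (z₂ y))))) (k : ℕ)
    (hk : 4 * k + r ≤ #s + 3 ∨
      (∀ y, b₂ (z₂ y) = a → g (e y) ≠ e (z₁ (b₁ a))) ∧ 4 * k + r ≤ #s + 4) :
    GoodProd k s g := by
  set S := insert (e a) (s \ univ.map e) with hS
  set P := viaEmbeddingHom e (z₁ * b₁) with hP
  set Q := viaEmbeddingHom e (b₂ * z₂) with hQ
  have hPe (y : Fin r) : P (e y) = e (z₁ (b₁ y)) := by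
    rw [hP, viaEmbeddingHom_apply, viaEmbedding_apply, Perm.mul_apply]
  have hQe (y : Fin r) : Q (e y) = e (b₂ (z₂ y)) := by
    rw [hQ, viaEmbeddingHom_apply, viaEmbedding_apply, Perm.mul_apply]
  have hPs (x : α) (hx : x ∉ s) : P x = x := by
    rw [hP, viaEmbeddingHom_apply]
    exact viaEmbedding_apply_of_notMem _ _ _ fun ⟨y, hy⟩ => hx (hy ▸ hes y)
  have hQs (x : α) (hx : x ∉ s) : Q x = x := by
    rw [hQ, viaEmbeddingHom_apply]
    exact viaEmbedding_apply_of_notMem _ _ _ fun ⟨y, hy⟩ => hx (hy ▸ hes y)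
  have hcard : #S + r = #s + 1 := by
    have hsub : univ.map e ⊆ s := fun x hx => by
      obtain ⟨y, -, rfl⟩ := mem_map.1 hx
      exact hes y
    have := card_le_card hsub
    rw [hS, card_insert_of_notMem (by simp), card_sdiff_of_subset hsub]
    rw [card_map, card_univ, Fintype.card_fin] at *
    omega
  have hQ' : sign Q = (-1) ^ r := by
    rw [← sign_viaEmbeddingHom_of_isBase e h₂ ha₂, hQ, map_mul, map_mul, map_mul, map_mul,
      mul_comm]
  have hP' : sign P = (-1) ^ r := sign_viaEmbeddingHom_of_isBase e h₁ ha₁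
  obtain ⟨c₁, c₂, C₁, C₂, hc₁, hc₂, hC₁, hC₂, haC₁, haC₂, hk₁, hk₂, hcc⟩ :=
    splits (s := S) (h := P⁻¹ * g * Q⁻¹) (a := e a) k (mem_insert_self _ _) (fun x hx => by
      rw [Perm.mul_apply, Perm.mul_apply, Perm.inv_eq_iff_eq]
      by_cases hxs : x ∈ s
      · have hxe : x ≠ e a ∧ x ∈ univ.map e := by
          simp only [hS, mem_insert, mem_sdiff, not_or, not_and, not_not] at hx
          exact ⟨hx.1, hx.2 hxs⟩
        obtain ⟨u, -, rfl⟩ := mem_map.1 hxe.2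
        have hu : u ≠ a := fun h => hxe.1 (h ▸ rfl)
        obtain ⟨y, rfl⟩ := (b₂ * z₂).surjective u
        rw [Perm.mul_apply] at *
        rw [hPe, ← hbase y hu]
        congr 1
        rw [Perm.inv_eq_iff_eq, hQe]
      · have : Q⁻¹ x = x := by rw [Perm.inv_eq_iff_eq, hQs x hxs]
        rw [this, hg x hxs, hPs x hxs]) (by
      rw [map_mul, map_mul, sign_inv, sign_inv, hsgn, hP', hQ', mul_one, ← mul_pow]
      simp) (by
      rcases hk with hk | ⟨hm, hk⟩
      · left; omega
      · right
        refine ⟨fun hc => ?_, by omega⟩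
        obtain ⟨y, hy⟩ := (b₂ * z₂).surjective a
        rw [Perm.mul_apply] at hy
        rw [Perm.mul_apply, Perm.mul_apply, Perm.inv_eq_iff_eq, hPe] at hc
        refine hm y hy (hc ▸ congrArg g ?_)
        rw [eq_comm, Perm.inv_eq_iff_eq, hQe, hy])
  have G₁ := good_of_split e h₁ ha₁ hes hc₁ hC₁ haC₁ hk₁ (Or.inl rfl)
  have G₂ := good_of_split e h₂ ha₂ hes hc₂ hC₂ haC₂ hk₂ (Or.inr rfl)
  refine ⟨_, _, G₁.1, G₂.1, ?_⟩
  rw [G₂.2.eq]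
  have : g = P * (P⁻¹ * g * Q⁻¹) * Q := by group
  rw [this, hcc, hP, hQ, map_mul, map_mul]
  group

/-- An even product of a three-cycle and a disjoint permutation of order prime to three. -/
def IsTame (d : Perm α) : Prop :=
  ∃ (z t : Perm α) (N : ℕ), z.IsThreeCycle ∧ Equiv.Perm.Disjoint z t ∧ t ^ N = 1 ∧ ¬ 3 ∣ N ∧
    d = z * t ∧ sign d = 1

theorem Good.sign {k : ℕ} {s : Finset α} {d : Perm α} (h : Good k s d) (hs : 4 + k ≤ #s) :
    sign d = (-1) ^ (#s + k) := by
  obtain ⟨z, t, B, hz, -, -, -, ht, hk, rfl⟩ := h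
  rw [map_mul, hz.sign, one_mul, ht.sign_eq (card_pos.1 (by omega)), ← hk,
    show #B + 3 + k + k = #B + 1 + 2 * (k + 1) by ring, pow_add _ (#B + 1)]
  simp

theorem Good.isTame {k : ℕ} {s : Finset α} {d : Perm α} (h : Good k s d) (hs : 4 + k ≤ #s)
    (h3 : #s % 3 ≠ k % 3) (h2 : (#s + k) % 2 = 0) : IsTame d := by
  have hsgn := h.sign hs
  obtain ⟨z, t, B, hz, -, -, hd, ht, hk, rfl⟩ := h
  refine ⟨z, t, #B, hz, ?_, ht.pow_card, by omega, rfl, ?_⟩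
  · rw [disjoint_iff_disjoint_support]
    exact Finset.disjoint_of_subset_right (support_subset_of_cycOn ht) hd
  · rw [hsgn, (Nat.even_iff.2 h2).neg_one_pow]

/-- `g` is a product of two elements of shape `IsTame`. -/
def TameProd (g : Perm α) : Prop :=
  ∃ d₁ d₂, IsTame d₁ ∧ IsTame d₂ ∧ g = d₁ * d₂

theorem GoodProd.tameProd {k : ℕ} {s : Finset α} {g : Perm α} (h : GoodProd k s g)
    (hs : 4 + k ≤ #s) (h3 : #s % 3 ≠ k % 3) (h2 : (#s + k) % 2 = 0) : TameProd g := by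
  obtain ⟨d₁, d₂, h₁, h₂, rfl⟩ := h
  exact ⟨d₁, d₂, h₁.isTame hs h3 h2, h₂.isTame hs h3 h2, rfl⟩

theorem disjoint_viaEmbeddingHom {α : Type*} [DecidableEq α] {r : ℕ} (e : Fin r ↪ α)
    (p : Perm (Fin r)) {c : Perm α}
    (hc : ∀ y, c (e y) = e y) : Equiv.Perm.Disjoint (viaEmbeddingHom e p) c := by
  intro x
  by_cases hx : x ∈ Set.range e
  · obtain ⟨y, rfl⟩ := hx
    exact Or.inr (hc y)
  · rw [viaEmbeddingHom_apply]
    exact Or.inl (viaEmbedding_apply_of_notMem _ _ _ hx)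

theorem isTame_viaEmbeddingHom {r : ℕ} (e : Fin r ↪ α) {z b : Perm (Fin r)} {N : ℕ}
    (h : #z.support = 3) (hd : ∀ x, z x = x ∨ b x = x) (hN : b ^ N = 1) {c : Perm α}
    {C : Finset α} (hc : CycOn c C) (hce : ∀ y, c (e y) = e y) (hC : C.Nonempty)
    (h3 : ¬ 3 ∣ N * #C) (hs : sign b = (-1) ^ (#C + 1)) :
    IsTame (viaEmbeddingHom e z * (viaEmbeddingHom e b * c)) := by
  have hzb : Equiv.Perm.Disjoint (viaEmbeddingHom e z) (viaEmbeddingHom e b) := by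
    intro x
    by_cases hx : x ∈ Set.range e
    · obtain ⟨y, rfl⟩ := hx
      simp only [viaEmbeddingHom_apply, viaEmbedding_apply]
      exact (hd y).imp (congrArg e) (congrArg e)
    · rw [viaEmbeddingHom_apply]
      exact Or.inl (viaEmbedding_apply_of_notMem _ _ _ hx)
  refine ⟨_, _, N * #C, isThreeCycle_viaEmbeddingHom e h,
    hzb.mul_right (disjoint_viaEmbeddingHom e z hce), ?_, h3, rfl, ?_⟩
  · rw [(disjoint_viaEmbeddingHom e b hce).commute.mul_pow, pow_mul, ← map_pow, hN, map_one,
      one_pow, mul_comm N, pow_mul c, hc.pow_card, one_pow, mul_one]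
  · rw [map_mul, map_mul, (isThreeCycle_viaEmbeddingHom e h).sign, hc.sign_eq hC, one_mul,
      viaEmbeddingHom_apply, viaEmbedding, sign_extendDomain, hs, ← mul_pow]
    simp

theorem tameProd_of_restrict {r : ℕ} (e : Fin r ↪ α) {z₁ b₁ z₂ b₂ : Perm (Fin r)}
    {N : ℕ} (h₁ : #z₁.support = 3) (h₂ : #z₂.support = 3) (hd₁ : ∀ x, z₁ x = x ∨ b₁ x = x)
    (hd₂ : ∀ x, z₂ x = x ∨ b₂ x = x) (hN₁ : b₁ ^ N = 1) (hN₂ : b₂ ^ N = 1)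
    {s : Finset α} {g : Perm α} (hes : ∀ y, e y ∈ s) (hg : ∀ x, x ∉ s → g x = x)
    (hsgn : sign g = 1)
    (hbase : ∀ y, g (e y) = e (z₁ (b₁ (z₂ (b₂ y))))) (k : ℕ)
    (hk : 4 * k + r ≤ #s + 2) (hr : r + k < #s) (h3 : ¬ 3 ∣ N * (#s - r - k))
    (hs₁ : sign b₁ = (-1) ^ (#s - r - k + 1)) (hs₂ : sign b₂ = (-1) ^ (#s - r - k + 1)) :
    TameProd g := by
  have hsub : univ.map e ⊆ s := fun x hx => by
    obtain ⟨y, -, rfl⟩ := mem_map.1 hx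
    exact hes y
  have hcard : #(s \ univ.map e) = #s - r := by
    rw [card_sdiff_of_subset hsub, card_map, card_univ, Fintype.card_fin]
  obtain ⟨a, ha⟩ : (s \ univ.map e).Nonempty := card_pos.1 (by omega)
  set D := viaEmbeddingHom e (z₁ * b₁ * (z₂ * b₂)) with hD
  have hDe (y : Fin r) : D (e y) = g (e y) := by
    rw [hbase, hD, viaEmbeddingHom_apply, viaEmbedding_apply]; simp
  have hDs (x : α) (hx : x ∉ s) : D x = x := by
    rw [hD, viaEmbeddingHom_apply]
    exact viaEmbedding_apply_of_notMem _ _ _ fun ⟨y, hy⟩ => hx (hy ▸ hes y)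
  have sz {z : Perm (Fin r)} (h : #z.support = 3) : sign z = 1 :=
    (card_support_eq_three_iff.1 h).sign
  obtain ⟨c₁, c₂, C₁, C₂, hc₁, hc₂, hC₁, hC₂, haC₁, haC₂, hk₁, hk₂, hcc⟩ :=
    splits (s := s \ univ.map e) (h := D⁻¹ * g) (a := a) k ha (fun x hx => by
      rw [Perm.mul_apply, Perm.inv_eq_iff_eq]
      by_cases hxs : x ∈ s
      · have hxe : x ∈ univ.map e := by
          by_contra hc
          exact hx (mem_sdiff.2 ⟨hxs, hc⟩)
        obtain ⟨y, -, rfl⟩ := mem_map.1 hxe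
        exact (hDe y).symm
      · rw [hg x hxs, hDs x hxs]) (by
      rw [map_mul, sign_inv, hsgn, hD, viaEmbeddingHom_apply, viaEmbedding, sign_extendDomain]
      simp only [map_mul, sz h₁, sz h₂, hs₁, hs₂, one_mul, mul_one]
      rw [← mul_pow]; simp) (by omega)
  have fixe {c : Perm α} {C : Finset α} (hc : CycOn c C) (hC : C ⊆ s \ univ.map e) (y : Fin r) :
      c (e y) = e y := hc.1 _ fun h => by simpa using hC h
  have e₁ : #C₁ = #s - r - k := by omega
  have e₂ : #C₂ = #s - r - k := by omega
  refine ⟨_, _, isTame_viaEmbeddingHom e h₁ hd₁ hN₁ hc₁ (fixe hc₁ hC₁) ⟨a, haC₁⟩ (e₁ ▸ h3)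
    (e₁ ▸ hs₁), isTame_viaEmbeddingHom e h₂ hd₂ hN₂ hc₂ (fixe hc₂ hC₂) ⟨a, haC₂⟩ (e₂ ▸ h3)
    (e₂ ▸ hs₂), ?_⟩
  have hg' : g = D * (D⁻¹ * g) := by group
  have hcomm := (disjoint_viaEmbeddingHom e (z₂ * b₂) (fixe hc₁ hC₁)).commute.eq
  rw [map_mul] at hcomm
  calc g = viaEmbeddingHom e z₁ * viaEmbeddingHom e b₁ *
        (viaEmbeddingHom e z₂ * viaEmbeddingHom e b₂ * c₁) * c₂ := by
        rw [hg', hcc, hD]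
        simp only [map_mul, mul_assoc]
    _ = _ := by
        rw [hcomm]
        simp only [mul_assoc]

end

section

variable {α : Type*} [Fintype α] [DecidableEq α]

/-- The data `z₁, b₁, z₂, b₂, a` factors every permutation which agrees with `σ` on all points of
`Fin r` except possibly the last one. -/
def IsCert {r : ℕ} (z₁ b₁ z₂ b₂ : Perm (Fin r)) (a : Fin r) (σ : Fin r → Fin r) : Prop :=
  IsBase z₁ b₁ ∧ IsBase z₂ b₂ ∧ z₁ a = a ∧ z₂ a = a ∧
    ∀ y, b₂ (z₂ y) ≠ a → z₁ (b₁ (b₂ (z₂ y))) = σ y ∧ (y : ℕ) + 1 < r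

instance {r : ℕ} (z₁ b₁ z₂ b₂ : Perm (Fin r)) (a : Fin r) (σ : Fin r → Fin r) :
    Decidable (IsCert z₁ b₁ z₂ b₂ a σ) := by
  unfold IsCert; infer_instance

/-- `g` is an even permutation supported on `s`. -/
def EvenOn (s : Finset α) (g : Perm α) : Prop :=
  (∀ x, x ∉ s → g x = x) ∧ sign g = 1

theorem IsCert.goodProd {r : ℕ} {z₁ b₁ z₂ b₂ : Perm (Fin r)} {a : Fin r} {σ : Fin r → Fin r}
    (h : IsCert z₁ b₁ z₂ b₂ a σ) {v : Fin r → α} (hv : (List.ofFn v).Nodup) {s : Finset α}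
    {g : Perm α} (hg : EvenOn s g)
    (hvs : ∀ x ∈ List.ofFn v, x ∈ s)
    (hσ : ∀ y : Fin r, (y : ℕ) + 1 < r → g (v y) = v (σ y)) {k : ℕ}
    (hk : 4 * k + r ≤ #s + 3 ∨
      (∀ y, b₂ (z₂ y) = a → g (v y) ≠ v (z₁ (b₁ a))) ∧ 4 * k + r ≤ #s + 4) :
    GoodProd k s g :=
  goodProd_of_graft ⟨v, List.nodup_ofFn.1 hv⟩ h.1 h.2.1 h.2.2.1 h.2.2.2.1
    (fun y => hvs _ (List.mem_ofFn.2 ⟨y, rfl⟩)) hg.1 hg.2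
    (fun y hy => by
      obtain ⟨h1, h2⟩ := h.2.2.2.2 y hy
      rw [h1]
      exact hσ y h2) k hk

variable {s : Finset α} {g : Perm α}

theorem goodProd_three (hg : EvenOn s g) {k : ℕ}
    {x₀ x₁ x₂ w : α} (hk : 4 * k + 1 ≤ #s)
    (hn : [x₀, x₁, x₂, w].Nodup)
    (hs : ∀ x ∈ [x₀, x₁, x₂, w], x ∈ s)
    (h0 : g x₀ = x₁) (h1 : g x₁ = x₂) (h2 : g x₂ = x₀) :
    GoodProd k s g :=
  IsCert.goodProd (r := 4) (z₁ := List.formPerm [0, 2, 1]) (b₁ := 1)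
    (z₂ := List.formPerm [0, 2, 1]) (b₂ := 1) (a := 3)
    (σ := ![1, 2, 0, 0]) (by decide +kernel) (v := ![x₀, x₁, x₂, w])
    (by simpa using hn) hg (by simpa using hs) (by simp [Fin.forall_fin_succ, *])
    (Or.inl (by omega))

theorem goodProd_fixed (hg : EvenOn s g) {k : ℕ}
    {x₀ x₁ x₂ w : α} (hk : 4 * k + 1 ≤ #s)
    (hn : [x₀, x₁, x₂, w].Nodup)
    (hs : ∀ x ∈ [x₀, x₁, x₂, w], x ∈ s)
    (h0 : g x₀ = x₀) (h1 : g x₁ = x₁) (h2 : g x₂ = x₂) :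
    GoodProd k s g :=
  IsCert.goodProd (r := 4) (z₁ := List.formPerm [0, 2, 1]) (b₁ := 1)
    (z₂ := List.formPerm [0, 1, 2]) (b₂ := 1) (a := 3)
    (σ := ![0, 1, 2, 0]) (by decide +kernel) (v := ![x₀, x₁, x₂, w])
    (by simpa using hn) hg (by simpa using hs) (by simp [Fin.forall_fin_succ, *])
    (Or.inl (by omega))

theorem goodProd_path (hg : EvenOn s g) {k : ℕ}
    {x₀ x₁ x₂ x₃ x₄ : α} (hk : 4 * k + 2 ≤ #s ∨ g x₄ ≠ x₀ ∧ 4 * k + 1 ≤ #s)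
    (hn : [x₀, x₁, x₂, x₃, x₄].Nodup)
    (hs : ∀ x ∈ [x₀, x₁, x₂, x₃, x₄], x ∈ s)
    (h0 : g x₀ = x₁) (h1 : g x₁ = x₂) (h2 : g x₂ = x₃) (h3 : g x₃ = x₄) :
    GoodProd k s g :=
  IsCert.goodProd (r := 5) (z₁ := List.formPerm [1, 4, 3]) (b₁ := List.formPerm [0, 2])
    (z₂ := List.formPerm [0, 3, 1]) (b₂ := List.formPerm [2, 4]) (a := 2)
    (σ := ![1, 2, 3, 4, 0]) (by decide +kernel) (v := ![x₀, x₁, x₂, x₃, x₄])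
    (by simpa using hn) hg (by simpa using hs) (by simp [Fin.forall_fin_succ, *]) (by
      rcases hk with hk | ⟨h, hk⟩
      · exact Or.inl (by omega)
      · refine Or.inr ⟨?_, by omega⟩
        intro y hy
        have hy' : y = 4 := by revert y; decide +kernel
        subst hy'
        have ha : List.formPerm [1, 4, 3] (List.formPerm [0, 2] (2 : Fin 5)) = 0 := by
          decide +kernel
        rw [ha]
        exact h)

theorem goodProd_two_two_one (hg : EvenOn s g) {k : ℕ}
    {x₀ x₁ y₀ y₁ u w : α} (hk : 4 * k + 3 ≤ #s)
    (hn : [x₀, x₁, y₀, y₁, u, w].Nodup)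
    (hs : ∀ x ∈ [x₀, x₁, y₀, y₁, u, w], x ∈ s)
    (h0 : g x₀ = x₁) (h1 : g x₁ = x₀) (h2 : g y₀ = y₁) (h3 : g y₁ = y₀) (h4 : g u = u) :
    GoodProd k s g :=
  IsCert.goodProd (r := 6) (z₁ := List.formPerm [0, 4, 3]) (b₁ := List.formPerm [1, 5, 2])
    (z₂ := List.formPerm [0, 2, 4]) (b₂ := List.formPerm [1, 3, 5]) (a := 1)
    (σ := ![1, 0, 3, 2, 4, 0]) (by decide +kernel) (v := ![x₀, x₁, y₀, y₁, u, w])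
    (by simpa using hn) hg (by simpa using hs) (by simp [Fin.forall_fin_succ, *])
    (Or.inl (by omega))

theorem goodProd_four_one (hg : EvenOn s g) {k : ℕ}
    {x₀ x₁ x₂ x₃ u y₀ y₁ : α} (hk : 4 * k + 4 ≤ #s)
    (hn : [x₀, x₁, x₂, x₃, u, y₀, y₁].Nodup)
    (hs : ∀ x ∈ [x₀, x₁, x₂, x₃, u, y₀, y₁], x ∈ s)
    (h0 : g x₀ = x₁) (h1 : g x₁ = x₂) (h2 : g x₂ = x₃) (h3 : g x₃ = x₀) (h4 : g u = u)
    (h5 : g y₀ = y₁) :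
    GoodProd k s g :=
  IsCert.goodProd (r := 7) (z₁ := List.formPerm [0, 2, 4]) (b₁ := List.formPerm [1, 6, 3, 5])
    (z₂ := List.formPerm [0, 5, 1]) (b₂ := List.formPerm [2, 6, 3, 4]) (a := 3)
    (σ := ![1, 2, 3, 0, 4, 6, 0]) (by decide +kernel) (v := ![x₀, x₁, x₂, x₃, u, y₀, y₁])
    (by simpa using hn) hg (by simpa using hs) (by simp [Fin.forall_fin_succ, *])
    (Or.inl (by omega))

theorem goodProd_four_four (hg : EvenOn s g) {k : ℕ}
    {x₀ x₁ x₂ x₃ y₀ y₁ y₂ y₃ : α} (hk : 4 * k + 5 ≤ #s)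
    (hn : [x₀, x₁, x₂, x₃, y₀, y₁, y₂, y₃].Nodup)
    (hs : ∀ x ∈ [x₀, x₁, x₂, x₃, y₀, y₁, y₂, y₃], x ∈ s)
    (h0 : g x₀ = x₁) (h1 : g x₁ = x₂) (h2 : g x₂ = x₃) (h3 : g x₃ = x₀) (h4 : g y₀ = y₁)
    (h5 : g y₁ = y₂) (h6 : g y₂ = y₃) :
    GoodProd k s g :=
  IsCert.goodProd (r := 8) (z₁ := List.formPerm [5, 7, 6]) (b₁ := List.formPerm [0, 2, 1, 3, 4])
    (z₂ := List.formPerm [0, 2, 1]) (b₂ := List.formPerm [3, 4, 6, 5, 7]) (a := 3)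
    (σ := ![1, 2, 3, 0, 5, 6, 7, 0]) (by decide +kernel) (v := ![x₀, x₁, x₂, x₃, y₀, y₁, y₂, y₃])
    (by simpa using hn) hg (by simpa using hs) (by simp [Fin.forall_fin_succ, *])
    (Or.inl (by omega))

theorem goodProd_path_two_two (hg : EvenOn s g) {k : ℕ}
    {x₀ x₁ y₀ y₁ u₀ u₁ x₂ : α} (hk : 4 * k + 4 ≤ #s)
    (hn : [x₀, x₁, y₀, y₁, u₀, u₁, x₂].Nodup)
    (hs : ∀ x ∈ [x₀, x₁, y₀, y₁, u₀, u₁, x₂], x ∈ s)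
    (h0 : g x₀ = x₁) (h1 : g x₁ = x₂) (h2 : g y₀ = y₁) (h3 : g y₁ = y₀) (h4 : g u₀ = u₁)
    (h5 : g u₁ = u₀) :
    GoodProd k s g :=
  IsCert.goodProd (r := 7) (z₁ := List.formPerm [6, 4, 3]) (b₁ := List.formPerm [0, 5, 2, 1])
    (z₂ := List.formPerm [0, 2, 4]) (b₂ := List.formPerm [1, 3, 5, 6]) (a := 1)
    (σ := ![1, 6, 3, 2, 5, 4, 0]) (by decide +kernel) (v := ![x₀, x₁, y₀, y₁, u₀, u₁, x₂])
    (by simpa using hn) hg (by simpa using hs) (by simp [Fin.forall_fin_succ, *])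
    (Or.inl (by omega))

theorem goodProd_twos (hg : EvenOn s g) {k : ℕ}
    {x₀ x₁ y₀ y₁ u₀ u₁ w₀ w₁ : α} (hk : 4 * k + 5 ≤ #s)
    (hn : [x₀, x₁, y₀, y₁, u₀, u₁, w₀, w₁].Nodup)
    (hs : ∀ x ∈ [x₀, x₁, y₀, y₁, u₀, u₁, w₀, w₁], x ∈ s)
    (h0 : g x₀ = x₁) (h1 : g x₁ = x₀) (h2 : g y₀ = y₁) (h3 : g y₁ = y₀) (h4 : g u₀ = u₁)
    (h5 : g u₁ = u₀) (h6 : g w₀ = w₁) :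
    GoodProd k s g :=
  IsCert.goodProd (r := 8) (z₁ := List.formPerm [1, 7, 2]) (b₁ := List.formPerm [0, 5, 6, 4, 3])
    (z₂ := List.formPerm [0, 2, 4]) (b₂ := List.formPerm [1, 3, 7, 5, 6]) (a := 5)
    (σ := ![1, 0, 3, 2, 5, 4, 7, 0]) (by decide +kernel) (v := ![x₀, x₁, y₀, y₁, u₀, u₁, w₀, w₁])
    (by simpa using hn) hg (by simpa using hs) (by simp [Fin.forall_fin_succ, *])
    (Or.inl (by omega))

theorem tameProd_two_two (hg : EvenOn s g) (hk : 8 ≤ #s) (h2 : #s % 2 = 0)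
    (h3 : #s % 3 ≠ 2) {x₀ x₁ y₀ y₁ : α} (hn : [x₀, x₁, y₀, y₁].Nodup)
    (hs : ∀ x ∈ [x₀, x₁, y₀, y₁], x ∈ s)
    (h0 : g x₀ = x₁) (h1 : g x₁ = x₀) (h2 : g y₀ = y₁) (h3 : g y₁ = y₀) :
    TameProd g := by
  have hv : (List.ofFn ![x₀, x₁, y₀, y₁]).Nodup := by simpa using hn
  have hvs : ∀ x ∈ List.ofFn ![x₀, x₁, y₀, y₁], x ∈ s := by simpa using hs
  have hsign : (-1 : ℤˣ) ^ (#s - 4 - 1 + 1) = 1 := (Nat.even_iff.2 (by omega)).neg_one_pow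
  refine tameProd_of_restrict (r := 4) ⟨![x₀, x₁, y₀, y₁], List.nodup_ofFn.1 hv⟩
    (z₁ := List.formPerm [1, 2, 0]) (b₁ := 1)
    (z₂ := List.formPerm [1, 2, 3]) (b₂ := 1) (N := 1)
    (by decide +kernel) (by decide +kernel) (by decide +kernel) (by decide +kernel)
    (by decide +kernel) (by decide +kernel) (fun y => hvs _ (List.mem_ofFn.2 ⟨y, rfl⟩))
    hg.1 hg.2 ?_ 1 (by omega) (by omega) (by omega) (by rw [hsign]; decide +kernel)
    (by rw [hsign]; decide +kernel)
  have key : ∀ y : Fin 4, (List.formPerm [1, 2, 0] : Perm (Fin _)) ((1 : Perm (Fin _))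
      ((List.formPerm [1, 2, 3] : Perm (Fin _)) ((1 : Perm (Fin _)) y))) = ![1, 0, 3, 2] y := by
    decide +kernel
  intro y
  rw [key]
  revert y
  simp [Fin.forall_fin_succ, *]

theorem tameProd_four_four (hg : EvenOn s g) (hk : 10 ≤ #s) (h2 : #s % 2 = 0)
    (h3 : #s % 3 ≠ 2) {x₀ x₁ x₂ x₃ y₀ y₁ y₂ y₃ : α} (hn : [x₀, x₁, x₂, x₃, y₀, y₁, y₂, y₃].Nodup)
    (hs : ∀ x ∈ [x₀, x₁, x₂, x₃, y₀, y₁, y₂, y₃], x ∈ s)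
    (h0 : g x₀ = x₁) (h1 : g x₁ = x₂) (h2 : g x₂ = x₃) (h3 : g x₃ = x₀) (h4 : g y₀ = y₁)
    (h5 : g y₁ = y₂) (h6 : g y₂ = y₃) (h7 : g y₃ = y₀) :
    TameProd g := by
  have hv : (List.ofFn ![x₀, x₁, x₂, x₃, y₀, y₁, y₂, y₃]).Nodup := by simpa using hn
  have hvs : ∀ x ∈ List.ofFn ![x₀, x₁, x₂, x₃, y₀, y₁, y₂, y₃], x ∈ s := by simpa using hs
  have hsign : (-1 : ℤˣ) ^ (#s - 8 - 0 + 1) = -1 := (Nat.odd_iff.2 (by omega)).neg_one_pow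
  refine tameProd_of_restrict (r := 8) ⟨![x₀, x₁, x₂, x₃, y₀, y₁, y₂, y₃], List.nodup_ofFn.1 hv⟩
    (z₁ := List.formPerm [0, 6, 2]) (b₁ := List.formPerm [5, 7, 4, 3])
    (z₂ := List.formPerm [2, 4, 3]) (b₂ := List.formPerm [0, 1, 6, 5]) (N := 4)
    (by decide +kernel) (by decide +kernel) (by decide +kernel) (by decide +kernel)
    (by decide +kernel) (by decide +kernel) (fun y => hvs _ (List.mem_ofFn.2 ⟨y, rfl⟩))
    hg.1 hg.2 ?_ 0 (by omega) (by omega) (by omega) (by rw [hsign]; decide +kernel)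
    (by rw [hsign]; decide +kernel)
  have key : ∀ y : Fin 8, (List.formPerm [0, 6, 2] : Perm (Fin _))
      ((List.formPerm [5, 7, 4, 3] : Perm (Fin _))
      ((List.formPerm [2, 4, 3] : Perm (Fin _)) ((List.formPerm [0, 1, 6, 5] : Perm (Fin _)) y))) =
      ![1, 2, 3, 0, 5, 6, 7, 4] y := by
    decide +kernel
  intro y
  rw [key]
  revert y
  simp [Fin.forall_fin_succ, *]

theorem tameProd_five (hg : EvenOn s g) (hk : 6 ≤ #s) (h2 : #s % 2 = 1)
    (h3 : #s % 3 ≠ 2) {x₀ x₁ x₂ x₃ x₄ : α} (hn : [x₀, x₁, x₂, x₃, x₄].Nodup)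
    (hs : ∀ x ∈ [x₀, x₁, x₂, x₃, x₄], x ∈ s)
    (h0 : g x₀ = x₁) (h1 : g x₁ = x₂) (h2 : g x₂ = x₃) (h3 : g x₃ = x₄) (h4 : g x₄ = x₀) :
    TameProd g := by
  have hv : (List.ofFn ![x₀, x₁, x₂, x₃, x₄]).Nodup := by simpa using hn
  have hvs : ∀ x ∈ List.ofFn ![x₀, x₁, x₂, x₃, x₄], x ∈ s := by simpa using hs
  have hsign : (-1 : ℤˣ) ^ (#s - 5 - 0 + 1) = -1 := (Nat.odd_iff.2 (by omega)).neg_one_pow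
  refine tameProd_of_restrict (r := 5) ⟨![x₀, x₁, x₂, x₃, x₄], List.nodup_ofFn.1 hv⟩
    (z₁ := List.formPerm [1, 0, 3]) (b₁ := List.formPerm [2, 4])
    (z₂ := List.formPerm [0, 3, 2]) (b₂ := List.formPerm [1, 4]) (N := 2)
    (by decide +kernel) (by decide +kernel) (by decide +kernel) (by decide +kernel)
    (by decide +kernel) (by decide +kernel) (fun y => hvs _ (List.mem_ofFn.2 ⟨y, rfl⟩))
    hg.1 hg.2 ?_ 0 (by omega) (by omega) (by omega) (by rw [hsign]; decide +kernel)
    (by rw [hsign]; decide +kernel)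
  have key : ∀ y : Fin 5, (List.formPerm [1, 0, 3] : Perm (Fin _))
      ((List.formPerm [2, 4] : Perm (Fin _))
      ((List.formPerm [0, 3, 2] : Perm (Fin _)) ((List.formPerm [1, 4] : Perm (Fin _)) y))) =
      ![1, 2, 3, 4, 0] y := by
    decide +kernel
  intro y
  rw [key]
  revert y
  simp [Fin.forall_fin_succ, *]

end

section

variable {α : Type*} [Fintype α] [DecidableEq α] {s : Finset α} {g : Perm α}

theorem exists_mem_notMem_list {α : Type*} [DecidableEq α] {s : Finset α} (l : List α)
    (h : l.length < #s) : ∃ w ∈ s, w ∉ l := by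
  by_contra! hc
  have h1 : #s ≤ #l.toFinset := card_le_card fun x hx => List.mem_toFinset.2 (hc x hx)
  have h2 := List.toFinset_card_le l
  omega

theorem EvenOn.exists_moved_of_cycOn (hg : EvenOn s g) {B : Finset α} (hB : B.Nonempty)
    (he : Even #B) (h : ∀ x ∈ B, ∀ y ∈ B, g.SameCycle x y) : ∃ y ∈ s, y ∉ B ∧ g y ≠ y := by
  by_contra! hc
  have hcyc : CycOn g B := ⟨fun x hx => by
    by_cases hxs : x ∈ s
    · exact hc x hxs hx
    · exact hg.1 x hxs, h⟩
  have := hcyc.sign_eq hB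
  rw [hg.2, (he.add_one).neg_one_pow] at this
  exact absurd this (by decide)

theorem EvenOn.exists_moved_of_two (hg : EvenOn s g) {x : α} (h : g x ≠ x) (h2 : g (g x) = x) :
    ∃ y ∈ s, y ∉ [x, g x] ∧ g y ≠ y := by
  have h1 : g.SameCycle x (g x) := sameCycle_apply_right.2 (SameCycle.refl _ _)
  obtain ⟨y, hy, hy', hm⟩ := hg.exists_moved_of_cycOn (B := {x, g x}) ⟨x, by simp⟩
    (by rw [card_pair h.symm]; decide) (by
      intro a ha b hb
      simp only [mem_insert, mem_singleton] at ha hb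
      rcases ha with rfl | rfl <;> rcases hb with rfl | rfl <;>
        first | exact SameCycle.refl _ _ | exact h1 | exact h1.symm)
  exact ⟨y, hy, by simpa using hy', hm⟩

theorem EvenOn.exists_moved_of_four (hg : EvenOn s g) {x : α}
    (hn : [x, g x, g (g x), g (g (g x))].Nodup) (h2 : g (g (g (g x))) = x) :
    ∃ y ∈ s, y ∉ [x, g x, g (g x), g (g (g x))] ∧ g y ≠ y := by
  have h0 (y : α) (hy : y ∈ [x, g x, g (g x), g (g (g x))]) : g.SameCycle x y := by
    have h1 : g.SameCycle x (g x) := sameCycle_apply_right.2 (SameCycle.refl _ _)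
    have h2 : g.SameCycle x (g (g x)) := sameCycle_apply_right.2 h1
    have h3 : g.SameCycle x (g (g (g x))) := sameCycle_apply_right.2 h2
    simp only [List.mem_cons, List.not_mem_nil, or_false] at hy
    rcases hy with rfl | rfl | rfl | rfl
    exacts [SameCycle.refl _ _, h1, h2, h3]
  obtain ⟨y, hy, hy', hm⟩ := hg.exists_moved_of_cycOn
    (B := [x, g x, g (g x), g (g (g x))].toFinset) ⟨x, by simp⟩
    (by rw [List.toFinset_card_of_nodup hn]; exact ⟨2, rfl⟩)
    (fun a ha b hb => (h0 a (List.mem_toFinset.1 ha)).symm.trans (h0 b (List.mem_toFinset.1 hb)))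
  exact ⟨y, hy, fun h => hy' (List.mem_toFinset.2 h), hm⟩

theorem nodup_five {α : Type*} {g : Perm α} {x : α} (h1 : g x ≠ x) (h2 : g (g x) ≠ x)
    (h3 : g (g (g x)) ≠ x)
    (h4 : g (g (g (g x))) ≠ x) : [x, g x, g (g x), g (g (g x)), g (g (g (g x)))].Nodup := by
  have hi : ∀ a b, g a = g b → a = b := fun a b h => g.injective h
  simp only [List.nodup_cons, List.mem_cons, List.not_mem_nil, List.nodup_nil, or_false, not_or]
  grind

set_option maxHeartbeats 1600000 in
/-- One of these configurations of short cycles occurs in every even permutation. -/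
theorem EvenOn.cases (hg : EvenOn s g) (hs : 8 ≤ #s) :
    (∃ x₀ x₁ x₂ w, [x₀, x₁, x₂, w].Nodup ∧ (∀ z ∈ [x₀, x₁, x₂, w], z ∈ s) ∧
      g x₀ = x₀ ∧ g x₁ = x₁ ∧ g x₂ = x₂) ∨
    (∃ x w, [x, g x, g (g x), w].Nodup ∧ (∀ z ∈ [x, g x, g (g x), w], z ∈ s) ∧
      g (g (g x)) = x) ∨
    (∃ x, [x, g x, g (g x), g (g (g x)), g (g (g (g x)))].Nodup ∧
      ∀ z ∈ [x, g x, g (g x), g (g (g x)), g (g (g (g x)))], z ∈ s) ∨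
    (∃ x u y, [x, g x, g (g x), g (g (g x)), u, y, g y].Nodup ∧
      (∀ z ∈ [x, g x, g (g x), g (g (g x)), u, y, g y], z ∈ s) ∧
      g (g (g (g x))) = x ∧ g u = u) ∨
    (∃ x y, [x, g x, g (g x), g (g (g x)), y, g y, g (g y), g (g (g y))].Nodup ∧
      (∀ z ∈ [x, g x, g (g x), g (g (g x)), y, g y, g (g y), g (g (g y))], z ∈ s) ∧
      g (g (g (g x))) = x ∧ g (g (g (g y))) = y) ∨
    (∃ x y u w, [x, g x, y, g y, u, w].Nodup ∧
      (∀ z ∈ [x, g x, y, g y, u, w], z ∈ s) ∧ g (g x) = x ∧ g (g y) = y ∧ g u = u) ∨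
    (∃ x y u, [x, g x, y, g y, u, g u, g (g x)].Nodup ∧
      (∀ z ∈ [x, g x, y, g y, u, g u, g (g x)], z ∈ s) ∧ g (g y) = y ∧ g (g u) = u) ∨
    ∃ x y u w, [x, g x, y, g y, u, g u, w, g w].Nodup ∧
      (∀ z ∈ [x, g x, y, g y, u, g u, w, g w], z ∈ s) ∧ g (g x) = x ∧ g (g y) = y ∧
      g (g u) = u := by
  have hi : ∀ a b, g a = g b → a = b := fun a b h => g.injective h
  have hm : ∀ a, a ∈ s → g a ∈ s := fun a h => apply_mem_of_fixes hg.1 h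
  have hm' : ∀ a, g a ≠ a → a ∈ s := fun a h => by
    by_contra hc; exact h (hg.1 a hc)
  by_cases h3 : ∃ x, g x ≠ x ∧ g (g (g x)) = x
  · obtain ⟨x, h1, h3⟩ := h3
    obtain ⟨w, hw, hwl⟩ := exists_mem_notMem_list (s := s) [x, g x, g (g x)]
      (by simp only [List.length_cons, List.length_nil]; omega)
    simp only [List.mem_cons, List.not_mem_nil, or_false, not_or] at hwl
    refine Or.inr (Or.inl ⟨x, w, ?_, ?_, h3⟩) <;>
      simp only [List.nodup_cons, List.mem_cons, List.not_mem_nil,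
        List.nodup_nil, or_false, not_or] <;> grind
  by_cases h5 : ∃ x, [x, g x, g (g x), g (g (g x)), g (g (g (g x)))].Nodup
  · obtain ⟨x, h5⟩ := h5
    refine Or.inr (Or.inr (Or.inl ⟨x, h5, ?_⟩))
    simp only [List.nodup_cons, List.mem_cons, List.not_mem_nil,
      List.nodup_nil, or_false, not_or] at h5 ⊢
    grind
  push Not at h3
  have tri (x : α) : g x = x ∨ (g x ≠ x ∧ g (g x) = x) ∨ (g (g x) ≠ x ∧ g (g (g (g x))) = x) := by
    by_contra! hc
    exact h5 ⟨x, nodup_five hc.1 (by grind) (by grind) (by grind)⟩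
  by_cases h4 : ∃ x, g (g x) ≠ x
  · obtain ⟨x, hx2⟩ := h4
    have hx4 : g (g (g (g x))) = x := by grind
    obtain ⟨y, hys, hy, hym⟩ := hg.exists_moved_of_four (x := x) (by
      simp only [List.nodup_cons, List.mem_cons, List.not_mem_nil, List.nodup_nil, or_false,
        not_or]
      grind) hx4
    simp only [List.mem_cons, List.not_mem_nil, or_false, not_or] at hy
    by_cases hu : ∃ u ∈ s, g u = u
    · obtain ⟨u, hus, hu⟩ := hu
      refine Or.inr (Or.inr (Or.inr (Or.inl ⟨x, u, y, ?_, ?_, hx4, hu⟩))) <;>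
        simp only [List.nodup_cons, List.mem_cons, List.not_mem_nil,
          List.nodup_nil, or_false, not_or] <;> grind
    by_cases hy4 : g (g y) = y
    · obtain ⟨u, hus, hul⟩ := exists_mem_notMem_list (s := s)
        [x, g x, g (g x), g (g (g x)), y, g y]
        (by simp only [List.length_cons, List.length_nil]; omega)
      simp only [List.mem_cons, List.not_mem_nil, or_false, not_or] at hul
      have hum : g u ≠ u := fun h => hu ⟨u, hus, h⟩
      by_cases hu4 : g (g u) = u
      · refine Or.inr (Or.inr (Or.inr (Or.inr (Or.inr (Or.inr (Or.inl
          ⟨x, y, u, ?_, ?_, hy4, hu4⟩)))))) <;>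
          simp only [List.nodup_cons, List.mem_cons, List.not_mem_nil,
            List.nodup_nil, or_false, not_or] <;> grind
      · refine Or.inr (Or.inr (Or.inr (Or.inr (Or.inl ⟨x, u, ?_, ?_, hx4, by grind⟩)))) <;>
          simp only [List.nodup_cons, List.mem_cons, List.not_mem_nil,
            List.nodup_nil, or_false, not_or] <;> grind
    · refine Or.inr (Or.inr (Or.inr (Or.inr (Or.inl ⟨x, y, ?_, ?_, hx4, by grind⟩)))) <;>
        simp only [List.nodup_cons, List.mem_cons, List.not_mem_nil,
          List.nodup_nil, or_false, not_or] <;> grind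
  push Not at h4
  by_cases hu : ∃ u ∈ s, g u = u
  · obtain ⟨u, hus, hu⟩ := hu
    by_cases hx : ∃ x, g x ≠ x
    · obtain ⟨x, hx⟩ := hx
      obtain ⟨y, hys, hy, hym⟩ := hg.exists_moved_of_two hx (h4 x)
      obtain ⟨w, hws, hwl⟩ := exists_mem_notMem_list (s := s) [x, g x, y, g y, u]
        (by simp only [List.length_cons, List.length_nil]; omega)
      simp only [List.mem_cons, List.not_mem_nil, or_false, not_or] at hwl hy
      refine Or.inr (Or.inr (Or.inr (Or.inr (Or.inr (Or.inl
          ⟨x, y, u, w, ?_, ?_, h4 x, h4 y, hu⟩))))) <;>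
        simp only [List.nodup_cons, List.mem_cons, List.not_mem_nil,
          List.nodup_nil, or_false, not_or] <;> grind
    · push Not at hx
      obtain ⟨x₁, hs₁, h₁⟩ := exists_mem_notMem_list (s := s) [u]
        (by simp only [List.length_cons, List.length_nil]; omega)
      obtain ⟨x₂, hs₂, h₂⟩ := exists_mem_notMem_list (s := s) [u, x₁]
        (by simp only [List.length_cons, List.length_nil]; omega)
      obtain ⟨x₃, hs₃, h₃⟩ := exists_mem_notMem_list (s := s) [u, x₁, x₂]
        (by simp only [List.length_cons, List.length_nil]; omega)
      simp only [List.mem_cons, List.not_mem_nil, or_false, not_or] at h₁ h₂ h₃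
      refine Or.inl ⟨u, x₁, x₂, x₃, ?_, ?_, hu, hx _, hx _⟩ <;>
        simp only [List.nodup_cons, List.mem_cons, List.not_mem_nil,
          List.nodup_nil, or_false, not_or] <;> grind
  · push Not at hu
    obtain ⟨x, hsx, -⟩ := exists_mem_notMem_list (s := s) []
      (by simp only [List.length_nil]; omega)
    obtain ⟨y, hsy, hy⟩ := exists_mem_notMem_list (s := s) [x, g x]
      (by simp only [List.length_cons, List.length_nil]; omega)
    obtain ⟨v, hsv, hv⟩ := exists_mem_notMem_list (s := s) [x, g x, y, g y]
      (by simp only [List.length_cons, List.length_nil]; omega)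
    obtain ⟨w, hsw, hw⟩ := exists_mem_notMem_list (s := s) [x, g x, y, g y, v, g v]
      (by simp only [List.length_cons, List.length_nil]; omega)
    simp only [List.mem_cons, List.not_mem_nil, or_false, not_or] at hy hv hw
    refine Or.inr (Or.inr (Or.inr (Or.inr (Or.inr (Or.inr (Or.inr
        ⟨x, y, v, w, ?_, ?_, h4 x, h4 y, h4 v⟩)))))) <;>
      simp only [List.nodup_cons, List.mem_cons, List.not_mem_nil,
        List.nodup_nil, or_false, not_or] <;> grind

theorem EvenOn.goodProd_zero (hg : EvenOn s g) (hs : 8 ≤ #s) : GoodProd 0 s g := by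
  rcases hg.cases hs with ⟨x₀, x₁, x₂, w, hn, hm, h₀, h₁, h₂⟩ |
    ⟨x, w, hn, hm, h⟩ |
    ⟨x, hn, hm⟩ |
    ⟨x, u, y, hn, hm, h1, h2⟩ |
    ⟨x, y, hn, hm, h1, h2⟩ |
    ⟨x, y, u, w, hn, hm, h1, h2, h3⟩ |
    ⟨x, y, u, hn, hm, h1, h2⟩ |
    ⟨x, y, u, w, hn, hm, h1, h2, h3⟩
  · exact goodProd_fixed hg (by omega) hn hm h₀ h₁ h₂
  · exact goodProd_three hg (by omega) hn hm rfl rfl h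
  · exact goodProd_path hg (Or.inl (by omega)) hn hm rfl rfl rfl rfl
  · exact goodProd_four_one hg (by omega) hn hm rfl rfl rfl h1 h2 rfl
  · exact goodProd_four_four hg (by omega) hn hm rfl rfl rfl h1 rfl rfl rfl
  · exact goodProd_two_two_one hg (by omega) hn hm rfl h1 rfl h2 h3
  · exact goodProd_path_two_two hg (by omega) hn hm rfl rfl rfl h1 rfl h2
  · exact goodProd_twos hg (by omega) hn hm rfl h1 rfl h2 rfl h3 rfl

theorem EvenOn.tameProd_of_three_dvd (hg : EvenOn s g) (hs : 12 ≤ #s) (h2 : #s % 2 = 0)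
    (h3 : #s % 3 = 0) : TameProd g := by
  have key (h : GoodProd 2 s g) : TameProd g := h.tameProd (by omega) (by omega) (by omega)
  rcases hg.cases (by omega) with ⟨x₀, x₁, x₂, w, hn, hm, h₀, h₁, h₂⟩ |
    ⟨x, w, hn, hm, h⟩ |
    ⟨x, hn, hm⟩ |
    ⟨x, u, y, hn, hm, h1, h2⟩ |
    ⟨x, y, hn, hm, h1, h2⟩ |
    ⟨x, y, u, w, hn, hm, h1, h2, h3⟩ |
    ⟨x, y, u, hn, hm, h1, h2⟩ |
    ⟨x, y, u, w, hn, hm, h1, h2, h3⟩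
  · exact key (goodProd_fixed hg (by omega) hn hm h₀ h₁ h₂)
  · exact key (goodProd_three hg (by omega) hn hm rfl rfl h)
  · exact key (goodProd_path hg (Or.inl (by omega)) hn hm rfl rfl rfl rfl)
  · exact key (goodProd_four_one hg (by omega) hn hm rfl rfl rfl h1 h2 rfl)
  · exact tameProd_four_four hg (by omega) (by omega) (by omega) hn hm rfl rfl rfl h1 rfl rfl rfl h2
  · exact tameProd_two_two hg (by omega) (by omega) (by omega) (x₀ := x) (y₀ := y)
      (by simp_all) (by simp_all) rfl h1 rfl h2
  · exact tameProd_two_two hg (by omega) (by omega) (by omega) (x₀ := y) (y₀ := u)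
      (by simp_all) (by simp_all) rfl h1 rfl h2
  · exact tameProd_two_two hg (by omega) (by omega) (by omega) (x₀ := x) (y₀ := y)
      (by simp_all) (by simp_all) rfl h1 rfl h2

end

section

variable {α : Type*} [Fintype α] [DecidableEq α] {H : Subgroup (Perm α)} {g : Perm α}

/-- `d` is an even permutation none of whose conjugates by even permutations is in `H`. -/
def Avoids (H : Subgroup (Perm α)) (d : Perm α) : Prop :=
  sign d = 1 ∧ ∀ x : Perm α, sign x = 1 → x * d * x⁻¹ ∉ H

/-- `g` is not a product of two even permutations avoiding the conjugates of `H`. -/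
def Bad (H : Subgroup (Perm α)) (g : Perm α) : Prop :=
  ∀ d₁ d₂, Avoids H d₁ → Avoids H d₂ → g ≠ d₁ * d₂

theorem Bad.exists_mem (hb : Bad H g) {P : Perm α → Prop}
    (hP : ∀ d x, P d → P (x * d * x⁻¹)) {d₁ d₂ : Perm α} (h₁ : P d₁) (h₂ : P d₂)
    (s₁ : sign d₁ = 1) (s₂ : sign d₂ = 1) (h : g = d₁ * d₂) : ∃ d ∈ H, P d := by
  by_contra! hc
  exact hb d₁ d₂ ⟨s₁, fun x _ hx => hc _ hx (hP _ _ h₁)⟩ ⟨s₂, fun x _ hx => hc _ hx (hP _ _ h₂)⟩ h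

theorem CycOn.conj {α : Type*} {f : Perm α} {B : Finset α} (h : CycOn f B) (x : Perm α) :
    CycOn (x * f * x⁻¹) (B.map x.toEmbedding) := by
  refine ⟨fun y hy => ?_, fun y hy z hz => ?_⟩
  · have : x⁻¹ y ∉ B := fun hc => hy (mem_map.2 ⟨_, hc, by simp⟩)
    rw [Perm.mul_apply, Perm.mul_apply, h.1 _ this, ← Perm.mul_apply, mul_inv_cancel,
      Perm.one_apply]
  · obtain ⟨y, hy', rfl⟩ := mem_map.1 hy
    obtain ⟨z, hz', rfl⟩ := mem_map.1 hz
    rw [sameCycle_conj]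
    simpa using h.2 y hy' z hz'

theorem Bad.exists_cycOn (hb : Bad H g) (k : ℕ) (hg : sign g = 1) {a : α}
    (hk : 4 * k ≤ Fintype.card α + 2 ∨ g a ≠ a ∧ 4 * k ≤ Fintype.card α + 3)
    (hpar : (Fintype.card α + k) % 2 = 1) :
    ∃ d ∈ H, ∃ B : Finset α, #B + k = Fintype.card α ∧ CycOn d B := by
  obtain ⟨c₁, c₂, B₁, B₂, h₁, h₂, -, -, hB₁, hB₂, e₁, e₂, h⟩ :=
    splits (s := univ) (h := g) (a := a) k (mem_univ a) (by simp) hg (by simpa using hk)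
  rw [card_univ] at e₁ e₂
  have hs {c : Perm α} {B : Finset α} (hc : CycOn c B) (ha : a ∈ B)
      (e : #B + k = Fintype.card α) : sign c = 1 := by
    rw [hc.sign_eq ⟨a, ha⟩, (Nat.even_iff.2 (by omega)).neg_one_pow]
  exact hb.exists_mem (P := fun d => ∃ B : Finset α, #B + k = Fintype.card α ∧ CycOn d B)
    (fun d x ⟨B, hB, h⟩ => ⟨_, by rwa [card_map], h.conj x⟩) ⟨B₁, e₁, h₁⟩ ⟨B₂, e₂, h₂⟩
    (hs h₁ hB₁ e₁) (hs h₂ hB₂ e₂) h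

theorem isPretransitive_of_forall_exists {α : Type*} {H : Subgroup (Perm α)} {a : α}
    (h : ∀ y, ∃ f ∈ H, f a = y) : MulAction.IsPretransitive H α :=
  (MulAction.isPretransitive_iff_base (G := H) a).2 fun y => by
    obtain ⟨f, hf, rfl⟩ := h y
    exact ⟨⟨f, hf⟩, rfl⟩

theorem isPreprimitive_of_cycOn [MulAction.IsPretransitive H α] {f : Perm α} (hf : f ∈ H)
    {B : Finset α} (h : CycOn f B) (hB : B.Nonempty) (hc : #B < Fintype.card α)
    (hlarge : Fintype.card α ≤ #B + 1 ∨
      Fintype.card α ≤ #B + 2 ∧ Fintype.card α % 2 = 1) :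
    MulAction.IsPreprimitive H α := by
  obtain ⟨a, ha⟩ : ∃ a, a ∉ B := by
    by_contra! hc'
    rw [eq_univ_of_forall hc', card_univ] at hc
    exact lt_irrefl _ hc
  refine MulAction.IsPreprimitive.of_isTrivialBlock_base a fun {X} haX hX => ?_
  have hfX (x : α) (hx : x ∈ X) : f x ∈ X := by
    have h1 := hX.smul_eq_of_mem (g := (⟨f, hf⟩ : H)) haX
      (by change f a ∈ X; rwa [h.1 a ha])
    rw [← h1]
    exact Set.smul_mem_smul_set hx
  have hpow (x : α) (hx : x ∈ X) (i : ℕ) : (f ^ i) x ∈ X := by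
    induction i with
    | zero => exact hx
    | succ i ih => rw [pow_succ', Perm.mul_apply]; exact hfX _ ih
  have hdvd := hX.ncard_dvd_card ⟨a, haX⟩
  rw [Nat.card_eq_fintype_card] at hdvd
  by_cases hXB : ∃ b ∈ B, b ∈ X
  · obtain ⟨b, hb, hbX⟩ := hXB
    right
    have hle : #(insert a B) ≤ X.ncard := by
      rw [← Set.ncard_coe_finset]
      refine Set.ncard_le_ncard (fun x hx => ?_) X.toFinite
      rcases mem_insert.1 hx with rfl | hx
      · exact haX
      · obtain ⟨i, rfl⟩ := h.exists_pow hb hx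
        exact hpow _ hbX i
    rw [card_insert_of_notMem ha] at hle
    have := card_pos.2 hB
    exact hX.eq_univ_of_card_lt (by rw [Nat.card_eq_fintype_card]; omega)
  · push Not at hXB
    left
    rw [← Set.ncard_le_one_iff_subsingleton]
    have hle : X.ncard ≤ #Bᶜ := by
      rw [← Set.ncard_coe_finset]
      exact Set.ncard_le_ncard (fun x hx => by simpa using fun h => hXB x h hx) (Set.toFinite _)
    rw [card_compl] at hle
    by_contra! hlt
    have h2 : X.ncard = 2 := by omega
    rw [h2] at hdvd
    omega

theorem IsTame.exists_pow {d : Perm α} (h : IsTame d) :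
    ∃ N, (d ^ N).IsThreeCycle := by
  obtain ⟨z, t, N, hz, hd, ht, hN, rfl, -⟩ := h
  refine ⟨N, ?_⟩
  rw [hd.commute.mul_pow, ht, mul_one]
  have h3 : z ^ 3 = 1 := by rw [← hz.orderOf, pow_orderOf_eq_one]
  have hmod : z ^ N = z ^ (N % 3) := by
    conv_lhs => rw [← Nat.div_add_mod N 3, pow_add, pow_mul, h3, one_pow, one_mul]
  rw [hmod]
  obtain h | h : N % 3 = 1 ∨ N % 3 = 2 := by omega
  · rwa [h, pow_one]
  · rw [h, sq]; exact hz.isThreeCycle_sq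

theorem IsTame.conj {d : Perm α} (h : IsTame d) (x : Perm α) : IsTame (x * d * x⁻¹) := by
  obtain ⟨z, t, N, hz, hd, ht, hN, rfl, hs⟩ := h
  refine ⟨x * z * x⁻¹, x * t * x⁻¹, N, ?_, ?_, ?_, hN, by group, ?_⟩
  · rw [IsThreeCycle, cycleType_conj]; exact hz
  · intro y
    rcases hd (x⁻¹ y) with h | h
    · left; rw [Perm.mul_apply, Perm.mul_apply, h, ← Perm.mul_apply, mul_inv_cancel, Perm.one_apply]
    · right; rw [Perm.mul_apply, Perm.mul_apply, h, ← Perm.mul_apply, mul_inv_cancel,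
        Perm.one_apply]
  · rw [conj_pow, ht]; simp
  · rw [map_mul, map_mul, hs]; simp

theorem Bad.not_tameProd (hb : Bad H g) (hH : ¬ alternatingGroup α ≤ H)
    (hp : MulAction.IsPreprimitive H α) : ¬ TameProd g := by
  rintro ⟨d₁, d₂, h₁, h₂, h⟩
  have hs {d : Perm α} (h : IsTame d) : sign d = 1 := by
    obtain ⟨_, _, _, _, _, _, _, _, hs⟩ := h
    exact hs
  obtain ⟨d, hd, ht⟩ := hb.exists_mem (P := IsTame) (fun d x h => h.conj x) h₁ h₂ (hs h₁) (hs h₂) h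
  obtain ⟨N, hN⟩ := ht.exists_pow
  exact hH (alternatingGroup_le_of_isPreprimitive_of_isThreeCycle_mem hp hN (pow_mem hd N))

theorem Bad.isPretransitive_of_odd (hb : Bad H g) (hg : sign g = 1)
    (hodd : Fintype.card α % 2 = 1) : MulAction.IsPretransitive H α := by
  obtain ⟨a⟩ : Nonempty α := Fintype.card_pos_iff.1 (by omega)
  obtain ⟨d, hd, B, hB, hcyc⟩ := hb.exists_cycOn 0 hg (a := a) (Or.inl (by omega)) (by omega)
  have hu : B = univ := (card_eq_iff_eq_univ B).1 hB
  subst hu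
  refine isPretransitive_of_forall_exists (a := a) fun y => ?_
  obtain ⟨i, hi⟩ := hcyc.exists_pow (mem_univ a) (mem_univ y)
  exact ⟨d ^ i, pow_mem hd i, hi⟩

theorem Bad.isPreprimitive_of_odd (hb : Bad H g) (hg : sign g = 1)
    (hodd : Fintype.card α % 2 = 1) (h7 : 7 ≤ Fintype.card α) : MulAction.IsPreprimitive H α := by
  obtain ⟨a⟩ : Nonempty α := Fintype.card_pos_iff.1 (by omega)
  have := hb.isPretransitive_of_odd hg hodd
  obtain ⟨d, hd, B, hB, hcyc⟩ := hb.exists_cycOn 2 hg (a := a) (Or.inl (by omega)) (by omega)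
  exact isPreprimitive_of_cycOn hd hcyc (card_pos.1 (by omega)) (by omega) (by omega)

theorem Bad.isPreprimitive_of_even (hb : Bad H g) (hg : sign g = 1)
    (heven : Fintype.card α % 2 = 0) (h2 : 2 ≤ Fintype.card α)
    {f : Perm α} (hf : f ∈ H) (hff : ∀ x, f x ≠ x) : MulAction.IsPreprimitive H α := by
  obtain ⟨b⟩ : Nonempty α := Fintype.card_pos_iff.1 (by omega)
  obtain ⟨d, hd, B, hB, hcyc⟩ := hb.exists_cycOn 1 hg (a := b) (Or.inl (by omega)) (by omega)
  obtain ⟨a, ha⟩ : ∃ a, Bᶜ = {a} := card_eq_one.1 (by rw [card_compl]; omega)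
  have hmem (x : α) (hx : x ≠ a) : x ∈ B := by
    by_contra hc
    exact hx (mem_singleton.1 (ha ▸ mem_compl.2 hc))
  have := isPretransitive_of_forall_exists (H := H) (a := a) fun y => by
    by_cases hy : y = a
    · exact ⟨1, one_mem H, hy.symm⟩
    · obtain ⟨i, hi⟩ := hcyc.exists_pow (hmem _ (hff a)) (hmem y hy)
      exact ⟨d ^ i * f, mul_mem (pow_mem hd i) hf, hi⟩
  exact isPreprimitive_of_cycOn hd hcyc (card_pos.1 (by omega)) (by omega) (by omega)

end

section

variable {α : Type*} [Fintype α] [DecidableEq α] {H : Subgroup (Perm α)} {g : Perm α}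

theorem CycOn.support_eq {t : Perm α} {B : Finset α} (h : CycOn t B) (hB : 2 ≤ #B) :
    t.support = B := by
  refine (support_subset_of_cycOn h).antisymm fun x hx => mem_support.2 fun hfix => ?_
  obtain ⟨y, hy, hyx⟩ := exists_mem_ne hB x
  obtain ⟨i, hi⟩ := h.exists_pow hx hy
  exact hyx (by rw [← hi, pow_apply_eq_self_of_apply_eq_self hfix])

theorem Good.apply_ne {d : Perm α} (h : Good 0 univ d) (hα : 5 ≤ Fintype.card α) (x : α) :
    d x ≠ x := by
  obtain ⟨z, t, B, hz, -, -, hd, ht, hk, rfl⟩ := h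
  rw [card_univ] at hk
  rw [← ht.support_eq (by omega)] at hd hk
  rw [← mem_support, (disjoint_iff_disjoint_support.2 hd).support_mul]
  suffices h : z.support ∪ t.support = univ by rw [h]; exact mem_univ x
  rw [← card_eq_iff_eq_univ, card_union_of_disjoint hd, hz.card_support]
  omega

theorem evenOn_univ (hg : sign g = 1) : EvenOn univ g := ⟨by simp, hg⟩

theorem Bad.false_of_even (hb : Bad H g) (hH : ¬ alternatingGroup α ≤ H) (hg : sign g = 1)
    (h8 : 8 ≤ Fintype.card α) (h2 : Fintype.card α % 2 = 0) : False := by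
  have hgood := (evenOn_univ hg).goodProd_zero (by rwa [card_univ])
  have hp : MulAction.IsPreprimitive H α := by
    obtain ⟨d₁, d₂, h₁, h₂, h⟩ := hgood
    have hs {d : Perm α} (h : Good 0 univ d) : sign d = 1 := by
      rw [h.sign (by rw [card_univ]; omega),
        (Nat.even_iff.2 (by rw [card_univ]; omega)).neg_one_pow]
    obtain ⟨f, hf, hff⟩ := hb.exists_mem (P := fun d => ∀ x, d x ≠ x)
      (fun d x h y hy => h (x⁻¹ y) (by
        rw [Perm.mul_apply, Perm.mul_apply] at hy
        rw [Perm.eq_inv_iff_eq, hy]))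
      (h₁.apply_ne (by omega)) (h₂.apply_ne (by omega)) (hs h₁) (hs h₂) h
    exact hb.isPreprimitive_of_even hg h2 (by omega) hf hff
  refine hb.not_tameProd hH hp ?_
  by_cases h3 : Fintype.card α % 3 = 0
  · exact (evenOn_univ hg).tameProd_of_three_dvd (by rw [card_univ]; omega)
      (by rwa [card_univ]) (by rwa [card_univ])
  · exact hgood.tameProd (by rw [card_univ]; omega) (by rwa [card_univ]) (by rw [card_univ]; omega)

theorem tameProd_of_odd (hg : sign g = 1) (h2 : Fintype.card α % 2 = 1)
    (h9 : 9 ≤ Fintype.card α) : TameProd g := by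
  have hu : #(univ : Finset α) = Fintype.card α := card_univ
  by_cases hfix : ∃ w, g w = w
  · obtain ⟨w, hw⟩ := hfix
    have he : EvenOn (univ.erase w) g := ⟨fun x hx => by
      obtain rfl : x = w := by simpa using hx
      exact hw, hg⟩
    have hcard : #(univ.erase w) = Fintype.card α - 1 := by
      rw [card_erase_of_mem (mem_univ w), card_univ]
    by_cases h3 : Fintype.card α % 3 = 1
    · exact he.tameProd_of_three_dvd (by omega) (by omega) (by omega)
    · exact (he.goodProd_zero (by omega)).tameProd (by omega) (by omega) (by omega)
  push Not at hfix
  have he := evenOn_univ hg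
  have key {k : ℕ} (h : GoodProd k univ g) (hk : k + 4 ≤ Fintype.card α) (hk2 : k % 2 = 1)
      (hk3 : Fintype.card α % 3 ≠ k % 3) : TameProd g :=
    h.tameProd (by omega) (by omega) (by omega)
  by_cases hthree : ∃ x, g (g (g x)) = x
  · obtain ⟨x, hx⟩ := hthree
    have h01 := hfix x
    have h12 := hfix (g x)
    have h20 : g (g x) ≠ x := fun h => hfix x (by rwa [h] at hx)
    obtain ⟨w, -, hw⟩ := exists_mem_notMem_list (s := univ) [x, g x, g (g x)]
      (by simp only [List.length_cons, List.length_nil]; omega)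
    have hn : [x, g x, g (g x), w].Nodup := by
      simp only [List.nodup_cons, List.mem_cons, List.not_mem_nil, List.nodup_nil, or_false,
        not_or] at hw ⊢
      grind
    by_cases h3 : Fintype.card α % 3 = 1
    · exact key (goodProd_three (k := 3) he (by omega) hn (by simp) rfl rfl hx) (by omega) rfl
        (by omega)
    · exact key (goodProd_three (k := 1) he (by omega) hn (by simp) rfl rfl hx) (by omega) rfl
        (by omega)
  push Not at hthree
  by_cases hpath : ∃ x, [x, g x, g (g x), g (g (g x)), g (g (g (g x)))].Nodup
  · obtain ⟨x, hn⟩ := hpath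
    by_cases h3 : Fintype.card α % 3 = 1
    · by_cases h5 : g (g (g (g (g x)))) = x
      · exact tameProd_five he (by omega) (by omega) (by omega) hn (by simp) rfl rfl rfl rfl h5
      · exact key (goodProd_path (k := 3) he (Or.inr ⟨h5, by omega⟩) hn (by simp) rfl rfl rfl rfl)
          (by omega) rfl (by omega)
    · exact key (goodProd_path (k := 1) he (Or.inl (by omega)) hn (by simp) rfl rfl rfl rfl)
        (by omega) rfl (by omega)
  have h4 (x : α) : g (g (g (g x))) = x := by
    by_contra hc
    exact hpath ⟨x, nodup_five (hfix x) (fun h => hc (by rw [h, h])) (hthree x) hc⟩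
  have hmod := card_fixedPoints_modEq (p := 2) (n := 2) (f := ⇑g)
    (funext h4)
  have hempty : Fintype.card (Function.fixedPoints g) = 0 :=
    Fintype.card_eq_zero_iff.2 ⟨fun x => hfix _ x.2⟩
  rw [hempty] at hmod
  have := hmod.symm
  unfold Nat.ModEq at this
  omega

theorem Bad.false_of_odd (hb : Bad H g) (hH : ¬ alternatingGroup α ≤ H) (hg : sign g = 1)
    (h9 : 9 ≤ Fintype.card α) (h2 : Fintype.card α % 2 = 1) : False :=
  hb.not_tameProd hH (hb.isPreprimitive_of_odd hg h2 (by omega)) (tameProd_of_odd hg h2 h9)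

end

section

section

variable {α : Type*} [Fintype α] [DecidableEq α] {H : Subgroup (Perm α)} {g : Perm α}

theorem Bad.false_of_card_eq_five (hb : Bad H g) (hH : ¬ alternatingGroup α ≤ H)
    (hg : sign g = 1) (h5 : Fintype.card α = 5) : False := by
  have := hb.isPretransitive_of_odd hg (by omega)
  obtain ⟨d, hd, B, hB, hcyc⟩ : ∃ d ∈ H, ∃ B : Finset α, #B + 2 = Fintype.card α ∧ CycOn d B := by
    by_cases h1 : g = 1
    · obtain ⟨B, -, hB⟩ := exists_subset_card_eq (s := (univ : Finset α)) (n := 3)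
        (by rw [card_univ]; omega)
      obtain ⟨f, hf⟩ := AltDerangement.exists_cycOn B
      have hs : sign f = 1 := by
        rw [hf.sign_eq (card_pos.1 (by omega)), hB]; rfl
      exact hb.exists_mem (P := fun d => ∃ B : Finset α, #B + 2 = Fintype.card α ∧ CycOn d B)
        (fun d x ⟨B, hB, h⟩ => ⟨_, by rwa [card_map], h.conj x⟩) ⟨B, by omega, hf⟩
        ⟨B, by omega, hf.inv⟩ hs (by rw [sign_inv, hs]) (by rw [h1, mul_inv_cancel])
    · obtain ⟨a, ha⟩ : ∃ a, g a ≠ a := by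
        by_contra! hc
        exact h1 (Perm.ext hc)
      exact hb.exists_cycOn 2 hg (Or.inr ⟨ha, by omega⟩) (by omega)
  have hp := isPreprimitive_of_cycOn hd hcyc (card_pos.1 (by omega)) (by omega) (by omega)
  have h3 : #d.support = 3 := by rw [hcyc.support_eq (by omega)]; omega
  exact hH (alternatingGroup_le_of_isPreprimitive_of_isThreeCycle_mem hp
    (card_support_eq_three_iff.1 h3) hd)

theorem Bad.exists_mem_of_cycleType (hb : Bad H g) {P : Perm α → Prop}
    (hP : ∀ d x, P d → P (x * d * x⁻¹)) {d₁ d₂ : Perm α} (h₁ : P d₁) (h₂ : P d₂)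
    (s₁ : sign d₁ = 1) (s₂ : sign d₂ = 1) (h : (d₁ * d₂).cycleType = g.cycleType) :
    ∃ d ∈ H, P d := by
  obtain ⟨x, hx⟩ := isConj_iff.1 (isConj_of_cycleType_eq h)
  exact hb.exists_mem hP (hP _ x h₁) (hP _ x h₂) (by simp [s₁]) (by simp [s₂])
    (by rw [← hx]; group)

theorem isTame_of_disjoint {z t : Perm α} (h3 : #z.support = 3) (hd : ∀ x, z x = x ∨ t x = x)
    (ht : t ^ 2 = 1) (hs : sign t = 1) : IsTame (z * t) :=
  have hz := card_support_eq_three_iff.1 h3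
  ⟨z, t, 2, hz, hd, ht, by decide, rfl, by rw [map_mul, hz.sign, hs, one_mul]⟩

theorem Bad.exists_isTame (hb : Bad H g) {z₁ t₁ z₂ t₂ : Perm α}
    (h₁ : #z₁.support = 3 ∧ (∀ x, z₁ x = x ∨ t₁ x = x) ∧ t₁ ^ 2 = 1 ∧ sign t₁ = 1)
    (h₂ : #z₂.support = 3 ∧ (∀ x, z₂ x = x ∨ t₂ x = x) ∧ t₂ ^ 2 = 1 ∧ sign t₂ = 1)
    (h : (z₁ * t₁ * (z₂ * t₂)).cycleType = g.cycleType) : ∃ d ∈ H, IsTame d := by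
  obtain ⟨a₁, b₁, c₁, e₁⟩ := h₁
  obtain ⟨a₂, b₂, c₂, e₂⟩ := h₂
  exact hb.exists_mem_of_cycleType (fun d x h => h.conj x) (isTame_of_disjoint a₁ b₁ c₁ e₁)
    (isTame_of_disjoint a₂ b₂ c₂ e₂)
    (by rw [map_mul, e₁, (card_support_eq_three_iff.1 a₁).sign, one_mul])
    (by rw [map_mul, e₂, (card_support_eq_three_iff.1 a₂).sign, one_mul]) h

theorem not_isTame (hH : ¬ alternatingGroup α ≤ H) (hp : MulAction.IsPreprimitive H α)
    {d : Perm α} (hd : d ∈ H) : ¬ IsTame d := fun h => by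
  obtain ⟨N, hN⟩ := h.exists_pow
  exact hH (alternatingGroup_le_of_isPreprimitive_of_isThreeCycle_mem hp hN (pow_mem hd N))

theorem multiset_cases {m : Multiset ℕ} (h2 : ∀ x ∈ m, 2 ≤ x) (hs : m.sum ≤ 7)
    (he : Even (m.sum + Multiset.card m)) :
    m = 0 ∨ m = {3} ∨ m = {2, 2} ∨ m = {5} ∨ m = {3, 3} ∨ m = {4, 2} ∨ m = {7} ∨
      m = {3, 2, 2} := by
  induction m using Quotient.inductionOn with | _ l => ?_
  simp only [Multiset.quot_mk_to_coe, Multiset.mem_coe, Multiset.sum_coe, Multiset.coe_card]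
    at h2 hs he ⊢
  rw [Nat.even_iff] at he
  match l with
  | [] => exact Or.inl rfl
  | [a] =>
    simp only [List.forall_mem_cons, List.sum_cons, List.sum_nil, List.length_cons,
      List.length_nil] at h2 hs he
    obtain ⟨ha, -⟩ := h2
    have : a ≤ 7 := by omega
    interval_cases a <;> first | omega | decide
  | [a, b] =>
    simp only [List.forall_mem_cons, List.sum_cons, List.sum_nil, List.length_cons,
      List.length_nil] at h2 hs he
    obtain ⟨ha, hb, -⟩ := h2
    have : a ≤ 5 := by omega
    have : b ≤ 5 := by omega
    interval_cases a <;> interval_cases b <;> first | omega | decide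
  | [a, b, c] =>
    simp only [List.forall_mem_cons, List.sum_cons, List.sum_nil, List.length_cons,
      List.length_nil] at h2 hs he
    obtain ⟨ha, hb, hc, -⟩ := h2
    have : a ≤ 3 := by omega
    have : b ≤ 3 := by omega
    have : c ≤ 3 := by omega
    interval_cases a <;> interval_cases b <;> interval_cases c <;> first | omega | decide
  | a :: b :: c :: d :: l =>
    simp only [List.forall_mem_cons, List.sum_cons] at h2 hs
    omega

theorem cycleType_cases (hg : sign g = 1) (h7 : Fintype.card α ≤ 7) :
    g.cycleType = 0 ∨ g.cycleType = {3} ∨ g.cycleType = {2, 2} ∨ g.cycleType = {5} ∨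
      g.cycleType = {3, 3} ∨ g.cycleType = {4, 2} ∨ g.cycleType = {7} ∨
      g.cycleType = {3, 2, 2} := by
  refine multiset_cases (fun x hx => two_le_of_mem_cycleType hx)
    ((sum_cycleType_le g).trans h7) ?_
  rw [sign_of_cycleType] at hg
  rcases Nat.even_or_odd (g.cycleType.sum + Multiset.card g.cycleType) with h | h
  · exact h
  · rw [h.neg_one_pow] at hg
    exact absurd hg (by decide)

end

theorem Bad.false_of_seven {H : Subgroup (Perm (Fin 7))} {g : Perm (Fin 7)} (hb : Bad H g)
    (hH : ¬ alternatingGroup (Fin 7) ≤ H) (hg : sign g = 1) : False := by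
  have hp := hb.isPreprimitive_of_odd hg (by rw [Fintype.card_fin]) (by rw [Fintype.card_fin])
  suffices h : ∃ d ∈ H, IsTame d by
    obtain ⟨d, hd, h⟩ := h
    exact not_isTame hH hp hd h
  rcases cycleType_cases hg (by rw [Fintype.card_fin]) with h | h | h | h | h | h | h | h
  · exact hb.exists_isTame (z₁ := List.formPerm [0, 1, 2]) (t₁ := 1)
      (z₂ := List.formPerm [0, 2, 1]) (t₂ := 1) (by decide +kernel) (by decide +kernel)
      (by rw [h]; decide +kernel)
  · exact hb.exists_isTame (z₁ := List.formPerm [0, 1, 2]) (t₁ := 1)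
      (z₂ := List.formPerm [0, 1, 2]) (t₂ := 1) (by decide +kernel) (by decide +kernel)
      (by rw [h]; decide +kernel)
  · exact hb.exists_isTame (z₁ := List.formPerm [0, 1, 2]) (t₁ := 1)
      (z₂ := List.formPerm [1, 2, 3]) (t₂ := 1) (by decide +kernel) (by decide +kernel)
      (by rw [h]; decide +kernel)
  · exact hb.exists_isTame (z₁ := List.formPerm [0, 1, 2]) (t₁ := 1)
      (z₂ := List.formPerm [2, 3, 4]) (t₂ := 1) (by decide +kernel) (by decide +kernel)
      (by rw [h]; decide +kernel)
  · exact hb.exists_isTame (z₁ := List.formPerm [0, 1, 2]) (t₁ := 1)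
      (z₂ := List.formPerm [3, 4, 5]) (t₂ := 1) (by decide +kernel) (by decide +kernel)
      (by rw [h]; decide +kernel)
  · exact hb.exists_isTame (z₁ := List.formPerm [1, 3, 5])
      (t₁ := List.formPerm [0, 4] * List.formPerm [2, 6]) (z₂ := List.formPerm [1, 6, 2])
      (t₂ := List.formPerm [0, 5] * List.formPerm [3, 4]) (by decide +kernel) (by decide +kernel)
      (by rw [h]; decide +kernel)
  · exact hb.exists_isTame (z₁ := List.formPerm [6, 3, 0])
      (t₁ := List.formPerm [2, 4] * List.formPerm [1, 5]) (z₂ := List.formPerm [2, 6, 3])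
      (t₂ := List.formPerm [0, 5] * List.formPerm [1, 4]) (by decide +kernel) (by decide +kernel)
      (by rw [h]; decide +kernel)
  · exact hb.exists_isTame (z₁ := List.formPerm [6, 5, 2])
      (t₁ := List.formPerm [3, 4] * List.formPerm [0, 1]) (z₂ := List.formPerm [1, 5, 2])
      (t₂ := 1) (by decide +kernel) (by decide +kernel)
      (by rw [h]; decide +kernel)

end

theorem exists_word_isThreeCycle_fin_six : ∀ a b c d e : Fin 6,
    let f := ![a, b, c, d, e, 0]
    let r : Fin 6 → Fin 6 := ![1, 2, 3, 4, 0, 5]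
    (∀ x, f x ≠ x) → (∀ x, f^[4] x = x) → (∃ x, f^[2] x ≠ x) →
    ∃ q ∈ ([(1, 1, 1, 1), (1, 1, 1, 4), (1, 4, 1, 4), (1, 1, 2, 2), (1, 2, 2, 1), (1, 3, 2, 4),
      (1, 4, 2, 3), (2, 1, 2, 1), (1, 1, 3, 2), (1, 1, 3, 3)] : List (ℕ × ℕ × ℕ × ℕ)),
      #{x | f^[q.1] (r^[q.2.1] (f^[q.2.2.1] (r^[q.2.2.2] x))) ≠ x} = 3 := by
  decide +kernel

theorem exists_isThreeCycle_of_fin_six {H : Subgroup (Perm (Fin 6))} {c e : Perm (Fin 6)}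
    (hc : c ∈ H) (he : e ∈ H) {B : Finset (Fin 6)} (hB : #B = 5) (hcyc : CycOn c B)
    (hfix : ∀ x, e x ≠ x) (h4 : e ^ 4 = 1) (h2 : e ^ 2 ≠ 1) : ∃ d ∈ H, d.IsThreeCycle := by
  obtain ⟨w, hw⟩ : ∃ w, Bᶜ = {w} := card_eq_one.1 (by rw [card_compl, Fintype.card_fin]; omega)
  have hmem (x : Fin 6) : x ∈ B ↔ x ≠ w := by
    rw [← not_iff_not, ← mem_compl, hw, mem_singleton, not_not]
  set y := e w with hy
  have hyB : y ∈ B := (hmem _).2 (hfix w)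
  have hpow (i : ℕ) : (c ^ i) y = y ↔ 5 ∣ i := by
    rw [hcyc.isCycleOn.pow_apply_eq hyB, hB]
  have hcB (x : Fin 6) (hx : x ∈ B) : c x ∈ B := apply_mem_of_fixes hcyc.1 hx
  have h5 : c (c (c (c (c y)))) = y := (hpow 5).2 (dvd_refl 5)
  have hn : [y, c y, c (c y), c (c (c y)), c (c (c (c y)))].Nodup :=
    nodup_five (fun h => absurd ((hpow 1).1 h) (by decide))
      (fun h => absurd ((hpow 2).1 h) (by decide)) (fun h => absurd ((hpow 3).1 h) (by decide))
      (fun h => absurd ((hpow 4).1 h) (by decide))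
  have hv : (List.ofFn ![y, c y, c (c y), c (c (c y)), c (c (c (c y))), w]).Nodup := by
    have h1 := (hmem _).1 hyB
    have h2 := (hmem _).1 (hcB _ hyB)
    have h3 := (hmem _).1 (hcB _ (hcB _ hyB))
    have h4 := (hmem _).1 (hcB _ (hcB _ (hcB _ hyB)))
    have h5 := (hmem _).1 (hcB _ (hcB _ (hcB _ (hcB _ hyB))))
    simp_all
  have hinj := List.nodup_ofFn.1 hv
  let p : Perm (Fin 6) := Equiv.ofBijective _ (Finite.injective_iff_bijective.1 hinj)
  have hcw : c w = w := hcyc.1 w fun h => (hmem w).1 h rfl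
  set r : Fin 6 → Fin 6 := ![1, 2, 3, 4, 0, 5] with hr
  have hcr : ⇑(p⁻¹ * c * p) = r := by
    funext i
    rw [Perm.mul_apply, Perm.mul_apply, Perm.inv_eq_iff_eq]
    revert i
    simp [Fin.forall_fin_succ, p, hr, h5, hcw]
  set e' := p⁻¹ * e * p with he'
  have he5 : e' 5 = 0 := by
    rw [he', Perm.mul_apply, Perm.mul_apply, Perm.inv_eq_iff_eq]
    rfl
  have hfe : ![e' 0, e' 1, e' 2, e' 3, e' 4, 0] = ⇑e' := by
    funext i
    revert i
    simp [Fin.forall_fin_succ, he5]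
  have hpw (k : ℕ) : e' ^ k = p⁻¹ * e ^ k * p := by
    simpa using conj_pow (a := p⁻¹) (b := e) (i := k)
  have key := exists_word_isThreeCycle_fin_six (e' 0) (e' 1) (e' 2) (e' 3) (e' 4)
  simp only [hfe, ← hr, ← hcr, ← coe_pow] at key
  obtain ⟨q, -, hq⟩ := key
    (fun x hx => hfix (p x) (by
      rwa [he', Perm.mul_apply, Perm.mul_apply, Perm.inv_eq_iff_eq] at hx))
    (fun x => by rw [hpw, h4]; simp) (by
      by_contra! hc
      have h1 : e' ^ 2 = 1 := Perm.ext hc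
      rw [hpw] at h1
      exact h2 (by simpa [mul_assoc, inv_mul_eq_one] using h1))
  refine ⟨e ^ q.1 * c ^ q.2.1 * e ^ q.2.2.1 * c ^ q.2.2.2,
    mul_mem (mul_mem (mul_mem (pow_mem he _) (pow_mem hc _)) (pow_mem he _)) (pow_mem hc _), ?_⟩
  have hcpw (k : ℕ) : (p⁻¹ * c * p) ^ k = p⁻¹ * c ^ k * p := by
    simpa using conj_pow (a := p⁻¹) (b := c) (i := k)
  have hconj : p⁻¹ * (e ^ q.1 * c ^ q.2.1 * e ^ q.2.2.1 * c ^ q.2.2.2) * p⁻¹⁻¹ =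
      e' ^ q.1 * (p⁻¹ * c * p) ^ q.2.1 * e' ^ q.2.2.1 * (p⁻¹ * c * p) ^ q.2.2.2 := by
    rw [hpw, hpw, hcpw, hcpw]
    group
  rw [IsThreeCycle, ← cycleType_conj (τ := p⁻¹), hconj, ← IsThreeCycle,
    ← card_support_eq_three_iff]
  exact hq

theorem Bad.false_of_six {H : Subgroup (Perm (Fin 6))} {g : Perm (Fin 6)} (hb : Bad H g)
    (hH : ¬ alternatingGroup (Fin 6) ≤ H) (hg : sign g = 1) : False := by
  obtain ⟨c, hc, B, hB, hcyc⟩ := hb.exists_cycOn 1 hg (a := 0)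
    (Or.inl (by rw [Fintype.card_fin]; omega)) (by rw [Fintype.card_fin])
  rw [Fintype.card_fin] at hB
  have prim {d : Perm (Fin 6)} (hd : d ∈ H) (hfix : ∀ x, d x ≠ x) :
      MulAction.IsPreprimitive H (Fin 6) :=
    hb.isPreprimitive_of_even hg (by rw [Fintype.card_fin]) (by rw [Fintype.card_fin]; omega)
      hd hfix
  have key {z₁ z₂ d₁ d₂ : Perm (Fin 6)} (h₁ : ∀ x, d₁ x ≠ x) (h₂ : ∀ x, d₂ x ≠ x)
      (s₁ : sign d₁ = 1) (s₂ : sign d₂ = 1) (h : (d₁ * d₂).cycleType = g.cycleType)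
      (hz : #z₁.support = 3 ∧ #z₂.support = 3)
      (hzg : (z₁ * z₂).cycleType = g.cycleType) : False := by
    obtain ⟨d, hd, hfix⟩ := hb.exists_mem_of_cycleType (P := fun d => ∀ x, d x ≠ x)
      (fun d x h y hy => h (x⁻¹ y) (by
        rw [Perm.mul_apply, Perm.mul_apply] at hy
        rw [Perm.eq_inv_iff_eq, hy])) h₁ h₂ s₁ s₂ h
    obtain ⟨e, he, ht⟩ := hb.exists_isTame (z₁ := z₁) (z₂ := z₂) (t₁ := 1) (t₂ := 1)
      ⟨hz.1, by simp⟩ ⟨hz.2, by simp⟩ (by simpa using hzg)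
    exact not_isTame hH (prim hd hfix) he ht
  rcases cycleType_cases hg (by rw [Fintype.card_fin]; omega) with h | h | h | h | h | h | h | h
  · exact key (d₁ := List.formPerm [0, 1, 2] * List.formPerm [3, 4, 5])
      (d₂ := List.formPerm [0, 2, 1] * List.formPerm [3, 5, 4]) (z₁ := List.formPerm [0, 1, 2])
      (z₂ := List.formPerm [0, 2, 1]) (by decide +kernel) (by decide +kernel) (by decide +kernel)
      (by decide +kernel) (by rw [h]; decide +kernel) (by decide +kernel)
      (by rw [h]; decide +kernel)
  · exact key (d₁ := List.formPerm [0, 2, 1] * List.formPerm [3, 4, 5])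
      (d₂ := List.formPerm [0, 2, 1] * List.formPerm [3, 5, 4]) (z₁ := List.formPerm [0, 1, 2])
      (z₂ := List.formPerm [0, 1, 2]) (by decide +kernel) (by decide +kernel) (by decide +kernel)
      (by decide +kernel) (by rw [h]; decide +kernel) (by decide +kernel)
      (by rw [h]; decide +kernel)
  · exact key (d₁ := List.formPerm [0, 2, 4] * List.formPerm [1, 3, 5])
      (d₂ := List.formPerm [0, 5, 3] * List.formPerm [1, 4, 2]) (z₁ := List.formPerm [0, 1, 2])
      (z₂ := List.formPerm [1, 2, 3]) (by decide +kernel) (by decide +kernel) (by decide +kernel)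
      (by decide +kernel) (by rw [h]; decide +kernel) (by decide +kernel)
      (by rw [h]; decide +kernel)
  · exact key (d₁ := List.formPerm [0, 2, 5] * List.formPerm [1, 4, 3])
      (d₂ := List.formPerm [0, 3, 1] * List.formPerm [2, 4, 5]) (z₁ := List.formPerm [0, 1, 2])
      (z₂ := List.formPerm [2, 3, 4]) (by decide +kernel) (by decide +kernel) (by decide +kernel)
      (by decide +kernel) (by rw [h]; decide +kernel) (by decide +kernel)
      (by rw [h]; decide +kernel)
  · exact key (d₁ := List.formPerm [0, 2, 1] * List.formPerm [3, 5, 4])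
      (d₂ := List.formPerm [0, 2, 1] * List.formPerm [3, 5, 4]) (z₁ := List.formPerm [0, 1, 2])
      (z₂ := List.formPerm [3, 4, 5]) (by decide +kernel) (by decide +kernel) (by decide +kernel)
      (by decide +kernel) (by rw [h]; decide +kernel) (by decide +kernel)
      (by rw [h]; decide +kernel)
  · obtain ⟨e, he, hfix, h4, h2⟩ := hb.exists_mem_of_cycleType
      (P := fun d => (∀ x, d x ≠ x) ∧ d ^ 4 = 1 ∧ d ^ 2 ≠ 1)
      (d₁ := List.formPerm [0, 2, 4, 1] * List.formPerm [3, 5])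
      (d₂ := List.formPerm [0, 4, 3, 1] * List.formPerm [2, 5])
      (fun d x h => ⟨fun y hy => h.1 (x⁻¹ y) (by
        rw [Perm.mul_apply, Perm.mul_apply] at hy
        rw [Perm.eq_inv_iff_eq, hy]), by rw [conj_pow, h.2.1]; simp, by
          rw [conj_pow]
          simpa [mul_inv_eq_one] using h.2.2⟩)
      (by decide +kernel) (by decide +kernel) (by decide +kernel) (by decide +kernel)
      (by rw [h]; decide +kernel)
    obtain ⟨z, hz, h3⟩ := exists_isThreeCycle_of_fin_six hc he (by omega) hcyc hfix h4 h2
    exact hH (alternatingGroup_le_of_isPreprimitive_of_isThreeCycle_mem (prim he hfix) h3 hz)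
  all_goals
    have := sum_cycleType_le g
    rw [h, Fintype.card_fin] at this
    exact absurd this (by decide)

theorem Bad.false {n : ℕ} (hn : 5 ≤ n) {H : Subgroup (Perm (Fin n))} {g : Perm (Fin n)}
    (hb : Bad H g) (hH : ¬ alternatingGroup (Fin n) ≤ H) (hg : sign g = 1) : False := by
  obtain rfl | rfl | rfl | h8 : n = 5 ∨ n = 6 ∨ n = 7 ∨ 8 ≤ n := by omega
  · exact hb.false_of_card_eq_five hH hg (Fintype.card_fin 5)
  · exact hb.false_of_six hH hg
  · exact hb.false_of_seven hH hg
  · rcases Nat.mod_two_eq_zero_or_one n with h | h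
    · exact hb.false_of_even hH hg (by rwa [Fintype.card_fin]) (by rwa [Fintype.card_fin])
    · exact hb.false_of_odd hH hg (by rw [Fintype.card_fin]; omega) (by rwa [Fintype.card_fin])

end AltDerangement

/-- if a transitive subgroup `G ≤ Sym(Ω)` of a finite set `Ω` is
isomorphic to `A_n` for some `n ≥ 5`, then every element of `G` is a product of
two derangements of `Ω` lying in `G`. -/
theorem stmt_14 (Ω : Type*) [Finite Ω] (G : Subgroup (Equiv.Perm Ω))
    (htrans : MulAction.IsPretransitive G Ω)
    (n : ℕ) (hn : 5 ≤ n)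
    (iso : G ≃* alternatingGroup (Fin n)) :
    ∀ g ∈ G, ∃ d₁ ∈ G, ∃ d₂ ∈ G,
      (∀ x : Ω, d₁ x ≠ x) ∧ (∀ x : Ω, d₂ x ≠ x) ∧ g = d₁ * d₂ := by
  intro g hg
  rcases isEmpty_or_nonempty Ω with hΩ | ⟨⟨ω⟩⟩
  · exact ⟨g, hg, 1, one_mem G, hΩ.elim, hΩ.elim, (mul_one g).symm⟩
  let φ : G →* Equiv.Perm (Fin n) := (alternatingGroup (Fin n)).subtype.comp iso.toMonoidHom
  have hφ : Function.Injective φ := Subtype.val_injective.comp iso.injective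
  have hφs (x : G) : Equiv.Perm.sign (φ x) = 1 := Equiv.Perm.mem_alternatingGroup.1 (iso x).2
  have hφr (d : Equiv.Perm (Fin n)) (hd : Equiv.Perm.sign d = 1) : ∃ x, φ x = d :=
    ⟨iso.symm ⟨d, Equiv.Perm.mem_alternatingGroup.2 hd⟩, by simp [φ]⟩
  have hH : ¬ alternatingGroup (Fin n) ≤ (MulAction.stabilizer G ω).map φ := fun hle => by
    have hstab (x : G) : x • ω = ω := by
      obtain ⟨y, hy, hxy⟩ := hle (Equiv.Perm.mem_alternatingGroup.2 (hφs x))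
      exact hφ hxy ▸ hy
    have hall (x : G) : x = 1 := by
      refine Subtype.ext (Equiv.ext fun y => ?_)
      obtain ⟨k, rfl⟩ := htrans.exists_smul_eq ω y
      rw [hstab k]
      exact hstab x
    have : Nontrivial (alternatingGroup (Fin n)) :=
      alternatingGroup.nontrivial_of_three_le_card (by rw [Nat.card_fin]; omega)
    obtain ⟨x, hx⟩ := exists_ne (1 : alternatingGroup (Fin n))
    exact hx (iso.symm.injective ((hall _).trans (hall _).symm))
  have hder (x : G) (hx : AltDerangement.Avoids ((MulAction.stabilizer G ω).map φ) (φ x)) (y : Ω) :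
      (x : Equiv.Perm Ω) y ≠ y := fun hy => by
    obtain ⟨k, rfl⟩ := htrans.exists_smul_eq ω y
    refine hx.2 (φ k⁻¹) (hφs _) ⟨k⁻¹ * x * k⁻¹⁻¹, ?_, by simp⟩
    have hy' : x • k • ω = k • ω := hy
    change (k⁻¹ * x * k⁻¹⁻¹) • ω = ω
    rw [inv_inv, mul_smul, mul_smul, hy', inv_smul_smul]
  by_contra hc
  refine AltDerangement.Bad.false hn (g := φ ⟨g, hg⟩) (fun d₁ d₂ h₁ h₂ h => ?_) hH (hφs _)
  obtain ⟨x₁, rfl⟩ := hφr d₁ h₁.1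
  obtain ⟨x₂, rfl⟩ := hφr d₂ h₂.1
  rw [← map_mul] at h
  exact hc ⟨x₁, x₁.2, x₂, x₂.2, hder x₁ h₁, hder x₂ h₂, congrArg Subtype.val (hφ h)⟩
end
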